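/- arXiv:1509.03680 — 3 statements merged into one kernel-verified Lean document; each statement's English description precedes it below -/
import Mathlib

section
/- For every pair of positive integers r and s, there exists a convex rational polygon P ⊂ ℝ² whose Ehrhart quasi-polynomial L_P(n) = c_2 n² + c_1(n) n + c_0(n) has: c_2 a constant, c_1 a periodic function with minimal period exactly s, and c_0 a periodic function with minimal period exactly r. -/
open Pointwise

/-- The number of lattice points in the `n`-th dilate of `S ⊆ ℝ²`. -/
noncomputable def ehr (S : Set (ℝ × ℝ)) (n : ℕ) : ℕ :=
  {z : ℤ × ℤ | ((z.1 : ℝ), (z.2 : ℝ)) ∈ (n : ℝ) • S}.ncard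

def loB (d : ℕ) : ℕ → ℕ
  | 0 => 0
  | b + 1 => b / d + 1

lemma loB_le (d b : ℕ) : loB d b ≤ b := by
  cases b with
  | zero => simp [loB]
  | succ b => simpa [loB] using Nat.div_le_self b d

lemma loB_iff (d b : ℕ) (h : d = 0 → b = 0) (x : ℤ) :
    ((loB d b : ℕ) : ℤ) ≤ x ↔ 0 ≤ x ∧ (b : ℤ) ≤ d * x := by
  cases b with
  | zero =>
    simp only [loB, Nat.cast_zero]
    constructor
    · intro hx; exact ⟨hx, by positivity⟩
    · exact fun hx => hx.1
  | succ b =>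
    have hd : 0 < d := by
      rcases Nat.eq_zero_or_pos d with h0 | h0
      · have := h h0; omega
      · exact h0
    have hd' : (0 : ℤ) < d := by exact_mod_cast hd
    simp only [loB, Nat.cast_add, Nat.cast_one]
    rw [Int.add_one_le_iff, Int.natCast_div, Int.ediv_lt_iff_lt_mul hd']
    constructor
    · intro hx
      have h2 : (0 : ℤ) < x * d := lt_of_le_of_lt (by positivity) hx
      have h3 : 0 < x := by
        by_contra hc
        push Not at hc
        nlinarith
      exact ⟨h3.le, by linarith⟩
    · rintro ⟨_, hx⟩
      linarith

lemma loB_sum (d : ℕ) : ∀ K q : ℕ, d * q ≤ K → K ≤ d * q + d →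
    2 * ∑ b ∈ Finset.range (K + 1), (loB d b : ℤ) = 2 * (q + 1) * K - d * q * (q + 1) := by
  intro K
  induction K with
  | zero =>
    intro q h1 h2
    have h3 : d * q = 0 := by omega
    have h4 : (d : ℤ) * q = 0 := by exact_mod_cast h3
    simp [loB, h4]
  | succ K ih =>
    intro q h1 h2
    rw [Finset.sum_range_succ, mul_add]
    by_cases h : d * q ≤ K
    · rw [ih q h (by omega)]
      have h5 : K / d = q := by
        apply Nat.div_eq_of_lt_le
        · linarith
        · linarith
      simp only [loB, h5]
      push_cast
      ring
    · have h6 : K + 1 = d * q := by omega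
      cases q with
      | zero => simp at h6
      | succ q =>
        have hd : 0 < d := by
          rcases Nat.eq_zero_or_pos d with h0 | h0
          · subst h0; simp at h6
          · exact h0
        have h7 : d * (q + 1) = d * q + d := by ring
        rw [ih q (by omega) (by omega)]
        have h5 : K / d = q := by
          apply Nat.div_eq_of_lt_le
          · linarith
          · linarith
        simp only [loB, h5]
        have h8 : (K : ℤ) = d * q + d - 1 := by
          have : ((K + 1 : ℕ) : ℤ) = ((d * q + d : ℕ) : ℤ) := by rw [h6, h7]
          push_cast at this
          linarith
        push_cast
        rw [h8]
        ring

lemma rows_ncard (m : ℕ) (σ lo hi : ℕ → ℤ) (hσ : Function.Injective σ)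
    (h : ∀ b < m, lo b ≤ hi b + 1) :
    {z : ℤ × ℤ | ∃ b < m, z.2 = σ b ∧ lo b ≤ z.1 ∧ z.1 ≤ hi b}.Finite ∧
    ({z : ℤ × ℤ | ∃ b < m, z.2 = σ b ∧ lo b ≤ z.1 ∧ z.1 ≤ hi b}.ncard : ℤ)
      = ∑ b ∈ Finset.range m, (hi b + 1 - lo b) := by
  classical
  have key : {z : ℤ × ℤ | ∃ b < m, z.2 = σ b ∧ lo b ≤ z.1 ∧ z.1 ≤ hi b}
      = ↑((Finset.range m).biUnion
        (fun b => (Finset.Icc (lo b) (hi b)).image (fun x => (x, σ b)))) := by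
    ext ⟨x, y⟩
    simp only [Set.mem_ofPred_eq, Finset.coe_biUnion, Finset.coe_range, Set.mem_Iio,
      Finset.coe_image, Set.mem_iUnion, Set.mem_image, Finset.mem_coe, Finset.mem_Icc,
      Prod.mk.injEq, exists_prop]
    constructor
    · rintro ⟨b, hb, h1, h2, h3⟩
      exact ⟨b, hb, x, ⟨h2, h3⟩, rfl, h1.symm⟩
    · rintro ⟨b, hb, x', ⟨h2, h3⟩, rfl, h1⟩
      exact ⟨b, hb, h1.symm, h2, h3⟩
  rw [key]
  refine ⟨Finset.finite_toSet _, ?_⟩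
  rw [Set.ncard_coe_finset, Finset.card_biUnion]
  · push_cast
    refine Finset.sum_congr rfl fun b hb => ?_
    rw [Finset.card_image_of_injective _ (fun a b hab => by simpa using hab), Int.card_Icc]
    have := h b (Finset.mem_range.1 hb)
    omega
  · intro a _ b _ hab
    rw [Function.onFun, Finset.disjoint_left]
    intro z hz hz'
    simp only [Finset.mem_image] at hz hz'
    obtain ⟨x, _, rfl⟩ := hz
    obtain ⟨x', _, h2⟩ := hz'
    exact hab (hσ (by simpa using (congrArg Prod.snd h2).symm))

lemma sum_lin (A B : ℤ) (m : ℕ) :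
    2 * ∑ b ∈ Finset.range m, (A - B * (b : ℤ)) = 2 * m * A - B * m * (m - 1) := by
  induction m with
  | zero => simp
  | succ m ih =>
    rw [Finset.sum_range_succ, mul_add, ih]
    push_cast
    ring

lemma count_all (d r n : ℕ) (hr : 0 < r) (hn : 0 < n) (K M N u : ℕ)
    (hN : N = n * (r * (d + 1) + 1))
    (hK : K = n * d / (d + 1)) (hM : M = N / r) (hu : u + K = n) :
    2 * ({z : ℤ × ℤ | z.2 * (d + 1) ≤ n * d ∧ z.2 ≤ d * z.1 ∧ 0 ≤ z.1 ∧
        z.1 + (d + 2) * z.2 ≤ N ∧ z.1 - r * z.2 ≤ N}.ncard : ℤ)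
      = 2 * (n + 1) * (N + 1) - (d + 2) * n * (n + 1) - 2 * u * (N - n * (d + 1))
        + M * (2 * (N + 1) - r * (M + 1)) := by
  have hK1 : K * (d + 1) ≤ n * d := by rw [hK]; exact Nat.div_mul_le_self _ _
  have hK2 : n * d < (K + 1) * (d + 1) := by
    rw [hK]; exact Nat.lt_mul_of_div_lt (Nat.lt_succ_self _) (Nat.succ_pos d)
  have hM1 : M * r ≤ N := by rw [hM]; exact Nat.div_mul_le_self _ _
  have hM2 : N < (M + 1) * r := by
    rw [hM]; exact Nat.lt_mul_of_div_lt (Nat.lt_succ_self _) hr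
  have hNn : n * (d + 2) ≤ N := by
    rw [hN]; apply Nat.mul_le_mul_left; nlinarith
  have hd0 : d = 0 → K = 0 := by rintro rfl; simpa using hK1
  have hu0 : 0 < u := by
    by_contra hc
    have : K = n := by omega
    subst this
    nlinarith
  -- rows
  obtain ⟨f1, c1⟩ := rows_ncard (K + 1) (fun b => (b : ℤ)) (fun b => (loB d b : ℤ))
    (fun b => (N : ℤ) - (d + 2) * b) (fun a b h => by simpa using h) (by
      intro b hb
      have h1 : (loB d b : ℤ) ≤ b := by exact_mod_cast loB_le d b
      have h2 : (b : ℤ) ≤ K := by exact_mod_cast Nat.lt_succ_iff.1 hb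
      zify at hK1 hNn
      have h3 : (d + 3 : ℤ) * b ≤ n * (d + 2) := by
        have : (d + 1 : ℤ) * ((d + 3 : ℤ) * b) ≤ (d + 1 : ℤ) * (n * (d + 2)) := by
          nlinarith [mul_le_mul_of_nonneg_left h2 (by positivity : (0 : ℤ) ≤ (d + 1) * (d + 3))]
        exact le_of_mul_le_mul_left this (by positivity)
      show (loB d b : ℤ) ≤ (N : ℤ) - (d + 2) * b + 1
      linarith)
  obtain ⟨f2, c2⟩ := rows_ncard M (fun b => -(b : ℤ) - 1) (fun b => 0)
    (fun b => (N : ℤ) - r * (b + 1)) (fun a b h => by simpa using h) (by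
      intro b hb
      have h2 : (b : ℤ) + 1 ≤ M := by exact_mod_cast hb
      zify at hM1
      show (0 : ℤ) ≤ (N : ℤ) - r * (b + 1) + 1
      nlinarith)
  have hset : {z : ℤ × ℤ | z.2 * (d + 1) ≤ n * d ∧ z.2 ≤ d * z.1 ∧ 0 ≤ z.1 ∧
        z.1 + (d + 2) * z.2 ≤ N ∧ z.1 - r * z.2 ≤ N} =
      {z : ℤ × ℤ | ∃ b < K + 1, z.2 = (b : ℤ) ∧ (loB d b : ℤ) ≤ z.1 ∧
        z.1 ≤ (N : ℤ) - (d + 2) * b} ∪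
      {z : ℤ × ℤ | ∃ b < M, z.2 = -(b : ℤ) - 1 ∧ 0 ≤ z.1 ∧ z.1 ≤ (N : ℤ) - r * (b + 1)} := by
    ext ⟨x, y⟩
    simp only [Set.mem_ofPred_eq, Set.mem_union]
    constructor
    · rintro ⟨h1, h2, h3, h4, h5⟩
      rcases le_or_gt 0 y with hy | hy
      · left
        obtain ⟨b, rfl⟩ := Int.eq_ofNat_of_zero_le hy
        have hb : b < K + 1 := by
          by_contra hc
          push Not at hc
          have h6 : b * (d + 1) ≤ n * d := by exact_mod_cast h1
          nlinarith
        refine ⟨b, hb, rfl, ?_, by linarith⟩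
        rw [loB_iff d b (fun h => by have := hd0 h; omega)]
        exact ⟨h3, h2⟩
      · right
        obtain ⟨b, hb⟩ := Int.eq_ofNat_of_zero_le (show 0 ≤ -y - 1 by omega)
        have hy' : y = -(b : ℤ) - 1 := by omega
        subst hy'
        refine ⟨b, ?_, rfl, h3, by linarith⟩
        by_contra hc
        push Not at hc
        zify at hc hM2
        have hr' : (0 : ℤ) < r := by exact_mod_cast hr
        nlinarith
    · rintro (⟨b, hb, rfl, h2, h3⟩ | ⟨b, hb, rfl, h2, h3⟩)
      · rw [loB_iff d b (fun h => by have := hd0 h; omega)] at h2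
        have hbK : (b : ℤ) ≤ K := by exact_mod_cast Nat.lt_succ_iff.1 hb
        zify at hK1
        have h0 : (0 : ℤ) ≤ b := by positivity
        have h00 : (0 : ℤ) ≤ d * b := by positivity
        have h01 : (0 : ℤ) ≤ r * b := by positivity
        have h10 : (b : ℤ) * (d + 1) ≤ K * (d + 1) := mul_le_mul_of_nonneg_right hbK (by positivity)
        exact ⟨h10.trans hK1, h2.2, h2.1, by linarith, by linarith⟩
      · have h0 : (0 : ℤ) ≤ b := by positivity
        have h00 : (0 : ℤ) ≤ d * b := by positivity
        have h02 : (0 : ℤ) ≤ d * x := by positivity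
        have h01 : (0 : ℤ) ≤ r * b := by positivity
        have h03 : (0 : ℤ) ≤ n * d := by positivity
        exact ⟨by linarith, by linarith, h2, by linarith, by linarith⟩
  have hdisj : Disjoint {z : ℤ × ℤ | ∃ b < K + 1, z.2 = (b : ℤ) ∧ (loB d b : ℤ) ≤ z.1 ∧
        z.1 ≤ (N : ℤ) - (d + 2) * b}
      {z : ℤ × ℤ | ∃ b < M, z.2 = -(b : ℤ) - 1 ∧ 0 ≤ z.1 ∧ z.1 ≤ (N : ℤ) - r * (b + 1)} := by
    rw [Set.disjoint_left]
    rintro ⟨x, y⟩ ⟨b, _, h1, _⟩ ⟨b', _, h2, _⟩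
    simp only at h1 h2
    omega
  rw [hset, Set.ncard_union_eq hdisj f1 f2]
  push_cast
  rw [c1, c2]
  have e1 : ∑ b ∈ Finset.range (K + 1), ((N : ℤ) - (d + 2) * b + 1 - (loB d b : ℤ))
      = ∑ b ∈ Finset.range (K + 1), (((N : ℤ) + 1) - (d + 2) * b)
        - ∑ b ∈ Finset.range (K + 1), (loB d b : ℤ) := by
    rw [← Finset.sum_sub_distrib]
    exact Finset.sum_congr rfl fun b _ => by ring
  have e2 : ∑ b ∈ Finset.range M, ((N : ℤ) - r * (b + 1) + 1 - 0)
      = ∑ b ∈ Finset.range M, (((N : ℤ) + 1 - r) - r * b) :=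
    Finset.sum_congr rfl fun b _ => by ring
  obtain ⟨q, rfl⟩ : ∃ q, u = q + 1 := ⟨u - 1, by omega⟩
  have hs3 := loB_sum d K q (by subst hu; nlinarith) (by subst hu; nlinarith)
  have hs1 := sum_lin ((N : ℤ) + 1) (d + 2) (K + 1)
  have hs2 := sum_lin ((N : ℤ) + 1 - r) r M
  rw [e1, e2, mul_add, mul_sub, hs1, hs2, hs3]
  have hn' : (n : ℤ) = q + 1 + K := by exact_mod_cast hu.symm
  rw [hn']
  push_cast
  ring

def pts (d r : ℕ) : Finset (ℚ × ℚ) :=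
  {(0, 0), ((r * (d + 1) + 1 : ℚ), 0), (0, -((r * (d + 1) + 1 : ℚ) / r)),
   (1 / (d + 1 : ℚ), d / (d + 1 : ℚ)),
   ((r * (d + 1) + 1 : ℚ) - (d + 2) * (d / (d + 1 : ℚ)), d / (d + 1 : ℚ))}

lemma hull_iff (d r : ℕ) (hr : 0 < r) (x y : ℝ) :
    (x, y) ∈ convexHull ℝ ((fun q : ℚ × ℚ => ((q.1 : ℝ), (q.2 : ℝ))) '' ↑(pts d r)) ↔
      y * (d + 1) ≤ d ∧ y ≤ d * x ∧ 0 ≤ x ∧ x + (d + 2) * y ≤ r * (d + 1) + 1 ∧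
        x - r * y ≤ r * (d + 1) + 1 := by
  have hr' : (1 : ℝ) ≤ r := by exact_mod_cast hr
  have hd' : (0 : ℝ) ≤ d := by positivity
  have hd1 : (0 : ℝ) < d + 1 := by positivity
  set W : ℝ := r * (d + 1) + 1 with hW
  have hWd : (d : ℝ) + 2 ≤ W := by nlinarith
  have hh : (d / (d + 1) : ℝ) * (d + 1) = d := by field_simp
  set h : ℝ := d / (d + 1) with hhd
  have hh0 : 0 ≤ h := by positivity
  have hg : (1 / (d + 1) : ℝ) = 1 - h := by rw [hhd]; field_simp; ring
  have hW0 : (0 : ℝ) < W := by linarith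
  have himg : ((fun q : ℚ × ℚ => ((q.1 : ℝ), (q.2 : ℝ))) '' ↑(pts d r)) =
      {((0 : ℝ), (0 : ℝ)), (W, 0), (0, -(W / r)), (1 - h, h), (W - (d + 2) * h, h)} := by
    rw [← hg]
    simp [pts, Set.image_insert_eq, hW, hhd]
  rw [himg]
  constructor
  · intro hx
    have hsub : convexHull ℝ ({((0 : ℝ), (0 : ℝ)), (W, 0), (0, -(W / r)), (1 - h, h),
        (W - (d + 2) * h, h)} : Set (ℝ × ℝ)) ⊆
        {p : ℝ × ℝ | p.2 * (d + 1) ≤ d ∧ p.2 ≤ d * p.1 ∧ 0 ≤ p.1 ∧ p.1 + (d + 2) * p.2 ≤ W ∧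
        p.1 - r * p.2 ≤ W} := by
      apply convexHull_min
      · have hWr : (r : ℝ) * (W / r) = W := by field_simp
        have hWr0 : 0 ≤ W / r := by positivity
        have hdh : 0 ≤ d * h := by positivity
        have hrh : 0 ≤ r * h := by positivity
        have hdw : 0 ≤ d * (W / r) := by positivity
        have hdW0 : 0 ≤ d * W := by positivity
        have h1 : h ≤ 1 := by nlinarith
        have hdd : d * h ≤ d := by nlinarith
        have hdW : d * (d + 2) ≤ d * W := by gcongr
        have key : h ≤ d * (W - (d + 2) * h) := by
          have hk : (d : ℝ) * ((d + 2) * h) = d * d + d - h := by linear_combination (d + 1) * hh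
          linarith
        rintro p hp
        simp only [Set.mem_insert_iff, Set.mem_singleton_iff] at hp
        rcases hp with rfl | rfl | rfl | rfl | rfl <;>
          refine ⟨?_, ?_, ?_, ?_, ?_⟩ <;> dsimp only <;> linarith
      · rintro p ⟨p1, p2, p3, p4, p5⟩ q ⟨q1, q2, q3, q4, q5⟩ a b ha hb hab
        obtain rfl : b = 1 - a := by linarith
        simp only [Set.mem_ofPred_eq, Prod.fst_add, Prod.snd_add, Prod.smul_fst, Prod.smul_snd,
          smul_eq_mul]
        refine ⟨?_, ?_, ?_, ?_, ?_⟩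
        · linarith [mul_le_mul_of_nonneg_left p1 ha, mul_le_mul_of_nonneg_left q1 hb]
        · linarith [mul_le_mul_of_nonneg_left p2 ha, mul_le_mul_of_nonneg_left q2 hb]
        · positivity
        · linarith [mul_le_mul_of_nonneg_left p4 ha, mul_le_mul_of_nonneg_left q4 hb]
        · linarith [mul_le_mul_of_nonneg_left p5 ha, mul_le_mul_of_nonneg_left q5 hb]
    exact hsub hx
  · rintro ⟨h1, h2, h3, h4, h5⟩
    set S : Set (ℝ × ℝ) := {((0 : ℝ), (0 : ℝ)), (W, 0), (0, -(W / r)), (1 - h, h),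
        (W - (d + 2) * h, h)} with hS
    have hc : Convex ℝ (convexHull ℝ S) := convex_convexHull ℝ S
    have m1 : ((0 : ℝ), (0 : ℝ)) ∈ convexHull ℝ S := subset_convexHull ℝ S (by simp [hS])
    have m2 : (W, (0 : ℝ)) ∈ convexHull ℝ S := subset_convexHull ℝ S (by simp [hS])
    have m3 : ((0 : ℝ), -(W / r)) ∈ convexHull ℝ S := subset_convexHull ℝ S (by simp [hS])
    have m4 : (1 - h, h) ∈ convexHull ℝ S := subset_convexHull ℝ S (by simp [hS])
    have m5 : (W - (d + 2) * h, h) ∈ convexHull ℝ S := subset_convexHull ℝ S (by simp [hS])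
    -- horizontal segments
    have hseg : ∀ a b : ℝ, (a, y) ∈ convexHull ℝ S → (b, y) ∈ convexHull ℝ S → a ≤ x → x ≤ b →
        (x, y) ∈ convexHull ℝ S := by
      intro a b ha hb hax hxb
      rcases eq_or_lt_of_le (hax.trans hxb) with hab | hab
      · have : x = a := by linarith
        rw [this]; exact ha
      · have hba : 0 < b - a := by linarith
        have := hc ha hb (a := (b - x) / (b - a)) (b := (x - a) / (b - a))
          (div_nonneg (by linarith) hba.le) (div_nonneg (by linarith) hba.le)
          (by field_simp; ring)
        convert this using 1
        ext
        · simp; field_simp; ring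
        · simp; field_simp; ring
    rcases le_or_gt 0 y with hy | hy
    · have hyh : y ≤ h := by
        rw [hhd, le_div_iff₀ hd1]; exact h1
      obtain ⟨t, ht0, ht1, hty, htx⟩ :
          ∃ t : ℝ, 0 ≤ t ∧ t ≤ 1 ∧ t * h = y ∧ t * (1 - h) ≤ x := by
        rcases eq_or_lt_of_le hd' with h0 | h0
        · have hz : h = 0 := by rw [hhd, ← h0]; simp
          exact ⟨0, le_rfl, zero_le_one, by linarith, by linarith⟩
        · have hp : 0 < h := by positivity
          have hq : y / h * h = y := by field_simp
          refine ⟨y / h, by positivity, (div_le_one hp).2 hyh, hq, ?_⟩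
          have : d * (y / h * (1 - h)) ≤ d * x := by
            have : d * (y / h * (1 - h)) = y / h * h := by linear_combination (-(y / h)) * hh
            linarith
          exact le_of_mul_le_mul_left this h0
      refine hseg (t * (1 - h)) (W - (d + 2) * y) ?_ ?_ htx (by linarith)
      · have := hc m1 m4 (a := 1 - t) (b := t) (by linarith) ht0 (by ring)
        convert this using 1
        ext
        · simp
        · simp [hty]
      · have := hc m2 m5 (a := 1 - t) (b := t) (by linarith) ht0 (by ring)
        convert this using 1
        ext
        · simp [← hty]; ring
        · simp [hty]
    · obtain ⟨t, ht0, ht1, hty⟩ : ∃ t : ℝ, 0 ≤ t ∧ t ≤ 1 ∧ t * (W / r) = -y := by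
        refine ⟨-y / (W / r), div_nonneg (by linarith) (by positivity), ?_, by field_simp⟩
        rw [div_le_one (by positivity), le_div_iff₀ (by positivity)]
        linarith
      have hty' : t * W = - y * r := by
        field_simp at hty; linarith
      refine hseg 0 (W + r * y) ?_ ?_ h3 (by linarith)
      · have := hc m1 m3 (a := 1 - t) (b := t) (by linarith) ht0 (by ring)
        convert this using 1
        ext
        · simp
        · simp; linarith
      · have := hc m2 m3 (a := 1 - t) (b := t) (by linarith) ht0 (by ring)
        convert this using 1
        ext
        · simp; linarith
        · simp; linarith

lemma ehr_eq (d r n : ℕ) (hr : 0 < r) (hn : 0 < n) :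
    ehr (convexHull ℝ ((fun q : ℚ × ℚ => ((q.1 : ℝ), (q.2 : ℝ))) '' ↑(pts d r))) n =
    {z : ℤ × ℤ | z.2 * (d + 1) ≤ n * d ∧ z.2 ≤ d * z.1 ∧ 0 ≤ z.1 ∧
        z.1 + (d + 2) * z.2 ≤ ((n * (r * (d + 1) + 1) : ℕ) : ℤ) ∧
        z.1 - r * z.2 ≤ ((n * (r * (d + 1) + 1) : ℕ) : ℤ)}.ncard := by
  unfold ehr
  congr 1
  ext ⟨x, y⟩
  have hn' : (0 : ℝ) < n := by exact_mod_cast hn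
  simp only [Set.mem_ofPred_eq]
  rw [Set.mem_smul_set_iff_inv_smul_mem₀ hn'.ne', Prod.smul_mk, hull_iff d r hr]
  simp only [smul_eq_mul]
  simp only [← Int.cast_le (R := ℝ)]
  push_cast
  have a1 : (n : ℝ)⁻¹ * y * (d + 1) ≤ d ↔ (y : ℝ) * (d + 1) ≤ n * d := by
    rw [mul_assoc, inv_mul_le_iff₀ hn']
  have a2 : (n : ℝ)⁻¹ * y ≤ d * ((n : ℝ)⁻¹ * x) ↔ (y : ℝ) ≤ d * x := by
    rw [inv_mul_le_iff₀ hn']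
    have : (n : ℝ) * (d * ((n : ℝ)⁻¹ * x)) = d * x := by field_simp
    rw [this]
  have a3 : 0 ≤ (n : ℝ)⁻¹ * x ↔ (0 : ℝ) ≤ x := by
    rw [mul_nonneg_iff_of_pos_left (by positivity)]
  have a4 : (n : ℝ)⁻¹ * x + (d + 2) * ((n : ℝ)⁻¹ * y) ≤ r * (d + 1) + 1 ↔
      (x : ℝ) + (d + 2) * y ≤ n * (r * (d + 1) + 1) := by
    rw [← inv_mul_le_iff₀ hn']; ring_nf
  have a5 : (n : ℝ)⁻¹ * x - r * ((n : ℝ)⁻¹ * y) ≤ r * (d + 1) + 1 ↔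
      (x : ℝ) - r * y ≤ n * (r * (d + 1) + 1) := by
    rw [← inv_mul_le_iff₀ hn']; ring_nf
  rw [a1, a2, a3, a4, a5]

/-- For all positive integers `r` and `s`, there is a convex rational polygon `P`
whose Ehrhart quasi-polynomial `c₂n² + c₁(n)n + c₀(n)` has constant leading
coefficient, linear coefficient of minimal period exactly `s`, and constant
coefficient of minimal period exactly `r`. -/
theorem stmt_5 (r s : ℕ) (hr : 0 < r) (hs : 0 < s) :
    ∃ V : Finset (ℚ × ℚ),
      ¬ Collinear ℝ ((fun q : ℚ × ℚ => ((q.1 : ℝ), (q.2 : ℝ))) '' ↑V) ∧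
      ∃ (c₂ : ℚ) (c₁ c₀ : ℕ → ℚ),
        (∀ n : ℕ, 0 < n →
          (ehr (convexHull ℝ ((fun q : ℚ × ℚ => ((q.1 : ℝ), (q.2 : ℝ))) '' ↑V)) n : ℚ)
            = c₂ * n ^ 2 + c₁ n * n + c₀ n) ∧
        IsLeast {p : ℕ | 0 < p ∧ ∀ n : ℕ, c₁ (n + p) = c₁ n} s ∧
        IsLeast {p : ℕ | 0 < p ∧ ∀ n : ℕ, c₀ (n + p) = c₀ n} r := by
  obtain ⟨d, rfl⟩ : ∃ d, s = d + 1 := ⟨s - 1, by omega⟩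
  have hrQ : (0 : ℚ) < r := by exact_mod_cast hr
  have hr1 : (1 : ℚ) ≤ r := by exact_mod_cast hr
  have hdQ : (0 : ℚ) < d + 1 := by positivity
  have hd0 : (0 : ℚ) ≤ d := by positivity
  refine ⟨pts d r, ?_, ?_⟩
  · intro hcol
    have p0 : ((0 : ℝ), (0 : ℝ)) ∈ (fun q : ℚ × ℚ => ((q.1 : ℝ), (q.2 : ℝ))) '' ↑(pts d r) :=
      ⟨(0, 0), by simp [pts], by simp⟩
    rw [collinear_iff_of_mem p0] at hcol
    obtain ⟨v, hv⟩ := hcol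
    obtain ⟨a, ha⟩ := hv ((r * (d + 1) + 1 : ℝ), 0)
      ⟨((r * (d + 1) + 1 : ℚ), 0), by simp [pts], by simp⟩
    obtain ⟨b, hb⟩ := hv (0, -((r * (d + 1) + 1 : ℝ) / r))
      ⟨(0, -((r * (d + 1) + 1 : ℚ) / r)), by simp [pts], by simp⟩
    have hrR : (0 : ℝ) < r := by exact_mod_cast hr
    have hWp : (0 : ℝ) < r * (d + 1) + 1 := by positivity
    have hWr : (0 : ℝ) < (r * (d + 1) + 1) / r := by positivity
    simp only [vadd_eq_add, Prod.ext_iff, Prod.fst_add, Prod.snd_add, Prod.smul_fst,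
      Prod.smul_snd, smul_eq_mul, add_zero] at ha hb
    have h1 : v.1 ≠ 0 := by
      intro h; rw [h] at ha; simp at ha; linarith [ha.1]
    have h2 : b = 0 := by
      rcases mul_eq_zero.1 hb.1.symm with h | h
      · exact h
      · exact absurd h h1
    rw [h2] at hb
    linarith [hb.2]
  · set W : ℚ := r * (d + 1) + 1 with hW
    have hl : 0 < W - (d + 1) := by nlinarith
    refine ⟨W - (d + 2) / 2 - (W - (d + 1)) / (d + 1) + W ^ 2 / (2 * r),
      fun n => W + 1 - (d + 2) / 2 - (W - (d + 1)) * (((n * d % (d + 1) : ℕ) : ℚ) / (d + 1))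
        + W * (1 / r - 1 / 2),
      fun n => 1 + ((n % r : ℕ) : ℚ) * (r - 2 - ((n % r : ℕ) : ℚ)) / (2 * r), ?_, ?_, ?_⟩
    · intro n hn
      rw [ehr_eq d r n hr hn]
      have hKn : n * d / (d + 1) ≤ n := by
        apply Nat.div_le_of_le_mul; nlinarith
      have hc := count_all d r n hr hn (n * d / (d + 1)) (n * (r * (d + 1) + 1) / r)
        (n * (r * (d + 1) + 1)) (n - n * d / (d + 1)) rfl rfl rfl (by omega)
      have e1 := Nat.div_add_mod (n * d) (d + 1)
      have e2 := Nat.div_add_mod (n * (r * (d + 1) + 1)) r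
      have e3 : n * (r * (d + 1) + 1) % r = n % r := by
        rw [show n * (r * (d + 1) + 1) = n + r * (n * (d + 1)) by ring, Nat.add_mul_mod_self_left]
      rw [e3] at e2
      have e4 : n - n * d / (d + 1) + n * d / (d + 1) = n := by omega
      generalize Set.ncard _ = c at hc ⊢
      generalize n * d / (d + 1) = K at *
      generalize n * (r * (d + 1) + 1) / r = M at *
      generalize n - K = u at *
      simp only []
      generalize n * d % (d + 1) = e at *
      generalize n % r = j at *
      have hc' := congrArg (Int.cast : ℤ → ℚ) hc
      have e1' := congrArg (Nat.cast : ℕ → ℚ) e1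
      have e2' := congrArg (Nat.cast : ℕ → ℚ) e2
      have e4' := congrArg (Nat.cast : ℕ → ℚ) e4
      push_cast at hc' e1' e2' e4'
      rw [← hW] at hc' e2'
      have u1 : (u : ℚ) = n - K := by linarith
      have u2 : (K : ℚ) = (n * d - e) / (d + 1) := by field_simp; linarith
      have u3 : (M : ℚ) = (n * W - j) / r := by field_simp; linarith
      rw [u1, u2, u3] at hc'
      have : (c : ℚ) = (2 * c) / 2 := by ring
      rw [this, hc']
      clear_value W
      field_simp
      ring
    · constructor
      · refine ⟨by omega, fun n => ?_⟩
        have : (n + (d + 1)) * d % (d + 1) = n * d % (d + 1) := by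
          rw [show (n + (d + 1)) * d = n * d + (d + 1) * d by ring, Nat.add_mul_mod_self_left]
        simp only [this]
      · rintro p ⟨hp, h⟩
        have h0 := h 0
        simp only [zero_add, zero_mul, Nat.zero_mod, Nat.cast_zero, zero_div, mul_zero] at h0
        have h1 : (W - (d + 1)) * (((p * d % (d + 1) : ℕ) : ℚ) / (d + 1)) = 0 := by linarith
        have h2 : ((p * d % (d + 1) : ℕ) : ℚ) = 0 := by
          rcases mul_eq_zero.1 h1 with h | h
          · exact absurd h hl.ne'
          · rcases div_eq_zero_iff.1 h with h | h
            · exact h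
            · exact absurd h hdQ.ne'
        have h3 : (d + 1) ∣ p * d := Nat.dvd_of_mod_eq_zero (by exact_mod_cast h2)
        have h4 : Nat.Coprime (d + 1) d := by simp
        exact Nat.le_of_dvd hp (h4.dvd_of_dvd_mul_right h3)
    · constructor
      · refine ⟨hr, fun n => ?_⟩
        simp only [Nat.add_mod_right]
      · rintro p ⟨hp, h⟩
        have h0 := h (r - 1)
        have hm : (r - 1) % r = r - 1 := Nat.mod_eq_of_lt (by omega)
        simp only [hm] at h0
        have hj : (r - 1 + p) % r < r := Nat.mod_lt _ hr
        have hjj : (r - 1 + p) % r = r - 1 := by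
          generalize (r - 1 + p) % r = j at *
          by_contra hne
          have hlt : j + 2 ≤ r := by omega
          have hlt' : (j : ℚ) + 2 ≤ r := by exact_mod_cast hlt
          have hr2 : (2 : ℚ) ≤ r := by exact_mod_cast (by omega : 2 ≤ r)
          rw [Nat.cast_sub hr] at h0
          have h5 : (0 : ℚ) ≤ j * (r - 2 - j) / (2 * r) :=
            div_nonneg (mul_nonneg (by positivity) (by linarith)) (by positivity)
          have h6 : ((r : ℚ) - 1) * (r - 2 - (r - 1)) / (2 * r) < 0 :=
            div_neg_of_neg_of_pos (by nlinarith) (by positivity)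
          push_cast at h0
          linarith
        have h7 : r ∣ p := by
          have h8 := Nat.div_add_mod (r - 1 + p) r
          rw [hjj] at h8
          exact ⟨(r - 1 + p) / r, by omega⟩
        exact Nat.le_of_dvd hp h7
end

section
/- If P ⊂ ℝ² is a convex polygon such that the convex hull of P ∩ ℤ² is two-dimensional and contains a lattice point in its interior, then either (int_P, bnd_P) = (1,9) or bnd_P ≤ 2·int_P + 6. -/
/-- The set of lattice points of `ℝ²`. -/
def latticeSet : Set (ℝ × ℝ) := {x | ∃ z : ℤ × ℤ, x = ((z.1 : ℝ), (z.2 : ℝ))}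

abbrev emb (z : ℤ × ℤ) : ℝ × ℝ := ((z.1 : ℝ), (z.2 : ℝ))
abbrev InL (P : Set (ℝ × ℝ)) : Set (ℤ × ℤ) := {z : ℤ × ℤ | ((z.1 : ℝ), (z.2 : ℝ)) ∈ interior P}
abbrev FrL (P : Set (ℝ × ℝ)) : Set (ℤ × ℤ) := {z : ℤ × ℤ | ((z.1 : ℝ), (z.2 : ℝ)) ∈ frontier P}

lemma lat_finite (P : Set (ℝ × ℝ)) (hK : IsCompact P) : {z : ℤ × ℤ | emb z ∈ P}.Finite := by
  obtain ⟨R, hR⟩ := hK.isBounded.exists_norm_le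
  apply ((Set.finite_Icc (-⌈R⌉) ⌈R⌉).prod (Set.finite_Icc (-⌈R⌉) ⌈R⌉)).subset
  rintro ⟨a, b⟩ h
  have h1 := hR _ h
  rw [Prod.norm_def, max_le_iff] at h1
  simp only [Real.norm_eq_abs, abs_le] at h1
  have h3 := Int.le_ceil R
  simp only [Set.mem_prod, Set.mem_Icc]
  obtain ⟨⟨h4, h5⟩, h6, h7⟩ := h1
  refine ⟨⟨?_, ?_⟩, ?_, ?_⟩ <;> (rify; linarith)

lemma trap1 (n : ℕ) (hn : 0 < n) (f : ℕ → ℝ) (a b : ℝ)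
    (h : ∀ k ≤ n, (n - k) * a + k * b ≤ n * f k) :
    n * (a + b) ≤ ∑ k ∈ Finset.range n, (f k + f (k + 1)) := by
  have hn' : (0 : ℝ) < n := by exact_mod_cast hn
  have key : ∀ m : ℕ, m ≤ n → 2 * n * m * a + m ^ 2 * (b - a) ≤
      n * ∑ k ∈ Finset.range m, (f k + f (k + 1)) := by
    intro m
    induction m with
    | zero => intro _; simp
    | succ m ih =>
      intro hm
      have h1 := ih (by omega)
      have h2 := h m (by omega)
      have h3 := h (m + 1) hm
      rw [Finset.sum_range_succ]
      push_cast at *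
      nlinarith
  have := key n le_rfl
  have h2 : (n : ℝ) * (n * (a + b)) ≤ n * ∑ k ∈ Finset.range n, (f k + f (k + 1)) := by
    nlinarith
  exact le_of_mul_le_mul_left h2 hn'

/-- f is bounded below by the piecewise linear function through (0,a),(m,x),(p,b) -/
lemma trap2 (m l : ℕ) (f : ℕ → ℝ) (a x b : ℝ) 
    (h : ∀ k ≤ m, (m - k) * a + k * x ≤ m * f k)
    (h' : ∀ k ≤ l, (l - k) * x + k * b ≤ l * f (m + k)) :
    m * (a + x) + l * (x + b) ≤ ∑ k ∈ Finset.range (m + l), (f k + f (k + 1)) := by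
  rw [Finset.sum_range_add]
  have h1 : m * (a + x) ≤ ∑ k ∈ Finset.range m, (f k + f (k + 1)) := by
    rcases Nat.eq_zero_or_pos m with h0 | h0
    · subst h0; simp
    · exact trap1 m h0 f a x h
  have h2 : l * (x + b) ≤ ∑ k ∈ Finset.range l, (f (m + k) + f (m + k + 1)) := by
    rcases Nat.eq_zero_or_pos l with h0 | h0
    · subst h0; simp
    · exact trap1 l h0 (fun k => f (m + k)) x b h'
  linarith

lemma trap_split (n : ℕ) (f : ℕ → ℝ) :
    ∑ k ∈ Finset.range (n + 1), (f k + f (k + 1)) =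
      2 * ∑ k ∈ Finset.range n, f (k + 1) + f 0 + f (n + 1) := by
  rw [Finset.sum_add_distrib, Finset.sum_range_succ', Finset.sum_range_succ (fun k => f (k+1))]
  ring

/-- one row. -/
lemma row (P : Set (ℝ × ℝ)) (hc : Convex ℝ P) (hK : IsCompact P) (y : ℤ)
    (hy : ∃ x : ℝ, (x, (y : ℝ)) ∈ interior P) :
    ∃ l r : ℝ, (∀ x : ℝ, (x, (y : ℝ)) ∈ P → l ≤ x ∧ x ≤ r) ∧
      {z ∈ FrL P | z.2 = y}.ncard ≤ 2 ∧ r - l - 1 ≤ {z ∈ InL P | z.2 = y}.ncard := by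
  obtain ⟨x0, hx0⟩ := hy
  set A : Set ℝ := {x | (x, (y : ℝ)) ∈ P} with hA
  have hAc : IsCompact A := by
    have : A ⊆ Prod.fst '' P := fun x hx => ⟨_, hx, rfl⟩
    refine (hK.image continuous_fst).of_isClosed_subset ?_ this
    exact hK.isClosed.preimage (by fun_prop : Continuous fun x : ℝ => (x, (y : ℝ)))
  have hx0A : x0 ∈ A := (interior_subset hx0 : (x0, (y : ℝ)) ∈ P)
  have hne : A.Nonempty := ⟨x0, hx0A⟩
  have hl := hAc.isLeast_sInf hne
  have hr := hAc.isGreatest_sSup hne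
  set l := sInf A
  set r := sSup A
  have hseg : ∀ x1 ∈ A, ∀ x : ℝ, x ∈ openSegment ℝ x0 x1 → (x, (y : ℝ)) ∈ interior P := by
    rintro x1 h1 x ⟨s, t, hs, ht, hst, rfl⟩
    apply hc.openSegment_interior_self_subset_interior hx0 h1
    refine ⟨s, t, hs, ht, hst, ?_⟩
    ext <;> simp
    rw [← add_mul, hst, one_mul]
  have hin : ∀ x : ℝ, l < x → x < r → (x, (y : ℝ)) ∈ interior P := by
    intro x h1 h2
    rcases lt_trichotomy x x0 with h | h | h
    · apply hseg l hl.1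
      rw [openSegment_symm, openSegment_eq_Ioo (h1.trans h)]
      exact ⟨h1, h⟩
    · rw [h]; exact hx0
    · apply hseg r hr.1
      rw [openSegment_eq_Ioo (h.trans h2)]
      exact ⟨h, h2⟩
  refine ⟨l, r, fun x hx => ⟨hl.2 hx, hr.2 hx⟩, ?_, ?_⟩
  · have : {z ∈ FrL P | z.2 = y} ⊆ {(⌊l⌋, y), (⌊r⌋, y)} := by
      rintro ⟨a, b⟩ ⟨h1, h2⟩
      simp only at h2
      subst h2
      have h3 : (a : ℝ) ∈ A := hK.isClosed.frontier_subset h1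
      have h4 := hl.2 h3
      have h5 := hr.2 h3
      have h6 : ¬ (l < a ∧ (a : ℝ) < r) := fun h => h1.2 (hin a h.1 h.2)
      rcases h4.lt_or_eq with h | h
      · have : (a : ℝ) = r := le_antisymm h5 (not_lt.1 fun h' => h6 ⟨h, h'⟩)
        right; simp [← this]
      · left; simp [h]
    refine (Set.ncard_le_ncard this (by simp)).trans ?_
    exact (Set.ncard_insert_le _ _).trans (by simp)
  · have hsub : (fun x : ℤ => (x, y)) '' (Set.Icc (⌊l⌋ + 1) (⌈r⌉ - 1)) ⊆ {z ∈ InL P | z.2 = y} := by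
      rintro _ ⟨x, ⟨h1, h2⟩, rfl⟩
      refine ⟨hin _ ?_ ?_, rfl⟩
      · exact Int.floor_lt.1 (show ⌊l⌋ < x by omega)
      · exact Int.lt_ceil.1 (show x < ⌈r⌉ by omega)
    have hfin : {z ∈ InL P | z.2 = y}.Finite :=
      (lat_finite P hK).subset fun z hz => (interior_subset (s := P) hz.1 : emb z ∈ P)
    have h1 := Set.ncard_le_ncard hsub hfin
    rw [Set.ncard_image_of_injective _ (fun a b h => by simpa using h), ← Finset.coe_Icc,
      Set.ncard_coe_finset, Int.card_Icc] at h1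
    have h2 : ⌈r⌉ - ⌊l⌋ - 1 ≤ ({z ∈ InL P | z.2 = y}.ncard : ℤ) := by omega
    have h3 := Int.le_ceil r
    have h4 := Int.floor_le l
    have h5 : ((⌈r⌉ - ⌊l⌋ - 1 : ℤ) : ℝ) ≤ (({z ∈ InL P | z.2 = y}.ncard : ℤ) : ℝ) := by
      exact_mod_cast h2
    rw [Int.cast_natCast] at h5
    push_cast at h5
    linarith

lemma fiber_sum (F : Set (ℤ × ℤ)) (hF : F.Finite) (y0 : ℤ) (p : ℕ)
    (h : ∀ z ∈ F, y0 ≤ z.2 ∧ z.2 ≤ y0 + p) :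
    F.ncard = ∑ k ∈ Finset.range (p + 1), {z ∈ F | z.2 = y0 + k}.ncard := by
  classical
  lift F to Finset (ℤ × ℤ) using hF
  rw [Set.ncard_coe_finset, Finset.card_eq_sum_card_fiberwise (f := fun z => (z.2 - y0).toNat)
    (t := Finset.range (p + 1))]
  · apply Finset.sum_congr rfl
    intro k _
    rw [← Set.ncard_coe_finset]
    congr 1
    ext z
    simp only [Finset.coe_filter, Set.mem_ofPred_eq, Finset.mem_coe]
    constructor
    · rintro ⟨h1, h2⟩; have := h z h1; exact ⟨h1, by omega⟩
    · rintro ⟨h1, h2⟩; exact ⟨h1, by omega⟩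
  · intro z hz
    have := h z hz
    simp; omega

lemma side (P : Set (ℝ × ℝ)) (hc : Convex ℝ P) (y0 : ℤ) (n : ℕ) (R : ℕ → ℝ)
    (hR : ∀ k : ℕ, 1 ≤ k → k ≤ n → ∀ x : ℝ, (x, ((y0 + k : ℤ) : ℝ)) ∈ P → x ≤ R k)
    (v u X : ℤ) (m : ℕ) (hm : m ≤ n + 1)
    (hv : emb (v, y0) ∈ P) (hv' : ∀ x : ℤ, emb (x, y0) ∈ P → x ≤ v)
    (hu : emb (u, y0 + (n + 1)) ∈ P) (hu' : ∀ x : ℤ, emb (x, y0 + (n + 1)) ∈ P → x ≤ u)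
    (hX : emb (X, y0 + m) ∈ P) :
    ((n : ℝ) + 1) * X + m * v + (n + 1 - m) * u ≤
      2 * ∑ k ∈ Finset.range n, R (k + 1) + v + u := by
  obtain ⟨l, hl⟩ : ∃ l, m + l = n + 1 := ⟨n + 1 - m, by omega⟩
  set f : ℕ → ℝ := fun k => if k = 0 then (v : ℝ) else if k = n + 1 then (u : ℝ) else R k with hf
  have gen : ∀ (a b : ℤ) (i j k : ℕ), emb (a, y0 + i) ∈ P → emb (b, y0 + j) ∈ P → i ≤ k → k ≤ j →
      j ≤ n + 1 → ((j : ℝ) - k) * a + (k - i) * b ≤ (j - i) * f k := by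
    intro a b i j k ha hb hik hkj hj
    rcases Nat.eq_zero_or_pos k with h0 | h0
    · subst h0
      obtain rfl : i = 0 := by omega
      have h1 : a ≤ v := hv' a (by simpa using ha)
      have h2 : (a : ℝ) ≤ v := by exact_mod_cast h1
      have h3 : (0 : ℝ) ≤ j := by positivity
      simp only [hf, if_true]
      push_cast
      nlinarith
    by_cases h1 : k = n + 1
    · obtain rfl : j = k := by omega
      have h1' : b ≤ u := hu' b (by rw [h1] at hb; simpa using hb)
      have h2 : (b : ℝ) ≤ u := by exact_mod_cast h1'
      have h3 : (i : ℝ) ≤ j := by exact_mod_cast hik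
      simp only [hf, if_neg h0.ne', if_pos h1]
      nlinarith
    · simp only [hf, if_neg h0.ne', if_neg h1]
      rcases hik.eq_or_lt with h2 | h2
      · subst h2
        have := hR i h0 (by omega) a (by simpa [emb] using ha)
        have h3 : (i : ℝ) ≤ j := by exact_mod_cast hkj
        nlinarith
      have h3 : (0 : ℝ) < j - i := by
        have : (i : ℝ) < j := by exact_mod_cast (by omega : i < j)
        linarith
      have h4 : (0 : ℝ) ≤ j - k := by
        have : (k : ℝ) ≤ j := by exact_mod_cast hkj
        linarith
      have h5 : (0 : ℝ) ≤ k - i := by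
        have : (i : ℝ) ≤ k := by exact_mod_cast hik
        linarith
      have h6 := hc ha hb (div_nonneg h4 h3.le) (div_nonneg h5 h3.le) (by field_simp; ring)
      have h7 := hR k h0 (by omega) ((((j : ℝ) - k) * a + (k - i) * b) / (j - i)) (by
        convert h6 using 1
        ext <;> simp
        · field_simp
        · field_simp; ring)
      rw [div_le_iff₀ h3] at h7
      linarith
  have hv0 : emb (v, y0 + (0 : ℕ)) ∈ P := by simpa using hv
  have hu0 : emb (u, y0 + (n + 1 : ℕ)) ∈ P := by simpa using hu
  have hfz : f 0 = v := by simp [hf]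
  have hft : f (n + 1) = u := by simp [hf]
  have hXf : (X : ℝ) ≤ f m := by
    rcases Nat.eq_zero_or_pos m with h0 | h0
    · subst h0; rw [hfz]; exact_mod_cast hv' X (by simpa using hX)
    · by_cases h1 : m = n + 1
      · rw [h1, hft]; exact_mod_cast hu' X (by rw [h1] at hX; simpa using hX)
      · simp only [hf, if_neg h0.ne', if_neg h1]
        exact hR m h0 (by omega) _ (by simpa [emb] using hX)
  have key := trap2 m l f v X u (fun k hk => by
      simpa using gen v X 0 m k hv0 hX (Nat.zero_le _) hk hm) (fun k hk => by
      have := gen X u m (n + 1) (m + k) hX hu0 (by omega) (by omega) le_rfl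
      rw [← hl] at this
      push_cast at this
      linarith)
  rw [hl, trap_split, hfz, hft] at key
  have e : ∑ k ∈ Finset.range n, f (k + 1) = ∑ k ∈ Finset.range n, R (k + 1) := by
    apply Finset.sum_congr rfl
    intro k hk
    have := Finset.mem_range.1 hk
    simp only [hf, if_neg (Nat.succ_ne_zero k), if_neg (by omega : ¬ k + 1 = n + 1)]
  rw [e] at key
  have hl' : (l : ℝ) = n + 1 - m := by
    have : (m : ℝ) + l = n + 1 := by exact_mod_cast hl
    linarith
  rw [hl'] at key
  linarith

lemma core (P : Set (ℝ × ℝ)) (hc : Convex ℝ P) (hK : IsCompact P) (hI : (interior P).Nonempty)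
    (y0 : ℤ) (n : ℕ)
    (hS : ∀ z : ℤ × ℤ, emb z ∈ P → y0 ≤ z.2 ∧ z.2 ≤ y0 + (n + 1))
    (v v' u u' : ℤ)
    (hv : emb (v, y0) ∈ P) (hv' : emb (v', y0) ∈ P)
    (hvv : ∀ x : ℤ, emb (x, y0) ∈ P → v ≤ x ∧ x ≤ v')
    (hu : emb (u, y0 + (n + 1)) ∈ P) (hu' : emb (u', y0 + (n + 1)) ∈ P)
    (huu : ∀ x : ℤ, emb (x, y0 + (n + 1)) ∈ P → u ≤ x ∧ x ≤ u') :
    ((FrL P).ncard : ℤ) ≤ (u' - u) + (v' - v) + 2 * (n + 1) ∧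
    ∀ z z' : ℤ × ℤ, emb z ∈ P → emb z' ∈ P →
      (n + 1) * z'.1 + (z'.2 - y0) * v' + (n + 1 - (z'.2 - y0)) * u'
        - ((n + 1) * z.1 + (z.2 - y0) * v + (n + 1 - (z.2 - y0)) * u)
      ≤ 2 * ((InL P).ncard : ℤ) + (u' - u) + (v' - v) + 2 * n := by
  have hrow : ∀ k : ℕ, 1 ≤ k → k ≤ n → ∃ x : ℝ, (x, ((y0 + k : ℤ) : ℝ)) ∈ interior P := by
    intro k h1 h2
    obtain ⟨⟨cx, cy⟩, hcI⟩ := hI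
    have gen : ∀ w : ℝ × ℝ, w ∈ P → ∀ s t : ℝ, 0 < s → 0 < t → s + t = 1 →
        s * cy + t * w.2 = ((y0 + k : ℤ) : ℝ) → ∃ x : ℝ, (x, ((y0 + k : ℤ) : ℝ)) ∈ interior P := by
      intro w hw s t hs ht hst he
      refine ⟨s * cx + t * w.1, ?_⟩
      apply hc.openSegment_interior_self_subset_interior hcI hw
      refine ⟨s, t, hs, ht, hst, ?_⟩
      ext <;> simp
      rw [he]; push_cast; rfl
    have h1' : (1 : ℝ) ≤ k := by exact_mod_cast h1
    have h2' : (k : ℝ) ≤ n := by exact_mod_cast h2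
    rcases lt_trichotomy cy ((y0 + k : ℤ) : ℝ) with h | h | h
    · push_cast at h
      have hd : 0 < (y0 + (n + 1) : ℝ) - cy := by linarith
      apply gen _ hu ((n + 1 - k) / ((y0 + (n + 1) : ℝ) - cy)) ((y0 + k - cy) / ((y0 + (n + 1) : ℝ) - cy))
        (div_pos (by linarith) hd) (div_pos (by linarith) hd)
      · field_simp; ring
      · push_cast; field_simp; ring
    · exact ⟨cx, by rw [← h]; exact hcI⟩
    · push_cast at h
      have hd : 0 < cy - y0 := by linarith
      apply gen _ hv (k / (cy - y0)) ((cy - y0 - k) / (cy - y0))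
        (div_pos (by linarith) hd) (div_pos (by linarith) hd)
      · field_simp; ring
      · push_cast; field_simp; ring
  have hrow2 : ∀ k : ℕ, ∃ l r : ℝ, 1 ≤ k → k ≤ n →
      ((∀ x : ℝ, (x, ((y0 + k : ℤ) : ℝ)) ∈ P → l ≤ x ∧ x ≤ r) ∧
      {z ∈ FrL P | z.2 = y0 + k}.ncard ≤ 2 ∧ r - l - 1 ≤ {z ∈ InL P | z.2 = y0 + k}.ncard) := by
    intro k
    by_cases h : 1 ≤ k ∧ k ≤ n
    · obtain ⟨l, r, h'⟩ := row P hc hK (y0 + k) (hrow k h.1 h.2)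
      exact ⟨l, r, fun _ _ => h'⟩
    · exact ⟨0, 0, fun h1 h2 => absurd ⟨h1, h2⟩ h⟩
  choose L R hLR using hrow2
  have hFf : (FrL P).Finite := (lat_finite P hK).subset fun z hz => hK.isClosed.frontier_subset hz
  have hIf : (InL P).Finite := (lat_finite P hK).subset fun z hz =>
    (interior_subset (s := P) hz : emb z ∈ P)
  have hFs := fiber_sum (FrL P) hFf y0 (n + 1) (fun z hz => by
    have := hS z (hK.isClosed.frontier_subset hz); push_cast; exact this)
  have hIs := fiber_sum (InL P) hIf y0 (n + 1) (fun z hz => by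
    have := hS z (interior_subset (s := P) hz); push_cast; exact this)
  have hend : ∀ (y a b : ℤ), a ≤ b → (∀ x : ℤ, emb (x, y) ∈ P → a ≤ x ∧ x ≤ b) →
      ({z ∈ FrL P | z.2 = y}.ncard : ℤ) ≤ b - a + 1 := by
    intro y a b hab h
    have hsub : {z ∈ FrL P | z.2 = y} ⊆ (fun x : ℤ => (x, y)) '' (Set.Icc a b) := by
      rintro ⟨x, y'⟩ ⟨h1, h2⟩
      simp only at h2
      subst h2
      exact ⟨x, h x (hK.isClosed.frontier_subset h1), rfl⟩
    have h1 := Set.ncard_le_ncard hsub ((Set.finite_Icc a b).image _)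
    rw [Set.ncard_image_of_injective _ (fun a b h => by simpa using h), ← Finset.coe_Icc,
      Set.ncard_coe_finset, Int.card_Icc] at h1
    omega
  rw [Finset.sum_range_succ, Finset.sum_range_succ'] at hFs hIs
  constructor
  · have h1 := hend y0 v v' (hvv v hv).2 hvv
    have h2 := hend (y0 + (n + 1)) u u' (huu u hu).2 huu
    have h3 : ∑ k ∈ Finset.range n, {z ∈ FrL P | z.2 = y0 + (k + 1 : ℕ)}.ncard ≤
        ∑ k ∈ Finset.range n, 2 :=
      Finset.sum_le_sum fun k hk =>
        (hLR (k + 1) (by omega) (by have := Finset.mem_range.1 hk; omega)).2.1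
    simp only [Finset.sum_const, Finset.card_range, smul_eq_mul] at h3
    push_cast at hFs h3
    rw [add_zero] at hFs
    rw [hFs]
    push_cast
    have h3' : ∑ k ∈ Finset.range n, ({z ∈ FrL P | z.2 = y0 + ((k : ℤ) + 1)}.ncard : ℤ) ≤ n * 2 := by
      exact_mod_cast h3
    linarith
  · intro z z' hz hz'
    have h3 : ∑ k ∈ Finset.range n, (R (k + 1) - L (k + 1) - 1) ≤
        ∑ k ∈ Finset.range n, ({z ∈ InL P | z.2 = y0 + (k + 1 : ℕ)}.ncard : ℝ) :=
      Finset.sum_le_sum fun k hk =>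
        (hLR (k + 1) (by omega) (by have := Finset.mem_range.1 hk; omega)).2.2
    have h4 : ∑ k ∈ Finset.range n, ({z ∈ InL P | z.2 = y0 + (k + 1 : ℕ)}.ncard : ℝ) ≤
        ((InL P).ncard : ℝ) := by
      rw [hIs, ← Nat.cast_sum]
      exact_mod_cast (by omega)
    simp only [Finset.sum_sub_distrib, Finset.sum_const, Finset.card_range, nsmul_eq_mul,
      mul_one] at h3
    obtain ⟨m', hm'⟩ := Int.eq_ofNat_of_zero_le (sub_nonneg.2 (hS z' hz').1)
    obtain ⟨m, hm⟩ := Int.eq_ofNat_of_zero_le (sub_nonneg.2 (hS z hz).1)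
    have b' := (hS z' hz').2
    have b := (hS z hz).2
    have e' : z'.2 = y0 + m' := by linarith
    have e : z.2 = y0 + m := by linarith
    have s1 := side P hc y0 n R (fun k h1 h2 x hx => ((hLR k h1 h2).1 x hx).2) v' u' z'.1 m'
      (by omega) hv' (fun x hx => (hvv x hx).2) hu' (fun x hx => (huu x hx).2)
      (by rw [← e']; exact hz')
    have hneg : ∀ x y : ℝ, (x, y) ∈ (fun w : ℝ × ℝ => (-w.1, w.2)) ⁻¹' P ↔ (-x, y) ∈ P :=
      fun x y => Iff.rfl
    have s2 := side ((fun w : ℝ × ℝ => (-w.1, w.2)) ⁻¹' P) (by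
        intro a ha b hb s t hs ht hst
        have := hc ha hb hs ht hst
        rw [Set.mem_preimage]
        convert this using 1
        ext <;> simp
        ring) y0 n (fun k => - L k)
      (fun k h1 h2 x hx => by
        have := ((hLR k h1 h2).1 (-x) hx).1
        linarith) (-v) (-u) (-z.1) m
      (by omega) (by simpa [emb, hneg] using hv)
      (fun x hx => by
        have := (hvv (-x) (by simpa [emb, hneg] using hx)).1
        omega) (by simpa [emb, hneg] using hu)
      (fun x hx => by
        have := (huu (-x) (by simpa [emb, hneg] using hx)).1
        omega)
      (by rw [← e]; simpa [emb, hneg] using hz)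
    rw [Finset.sum_neg_distrib] at s2
    rw [hm', hm]
    push_cast at s1 s2
    have : ((n : ℝ) + 1) * z'.1 + m' * v' + (n + 1 - m') * u'
        - ((n + 1) * z.1 + m * v + (n + 1 - m) * u)
      ≤ 2 * ((InL P).ncard : ℝ) + (u' - u) + (v' - v) + 2 * n := by linarith
    exact_mod_cast this

lemma transf (P : Set (ℝ × ℝ)) (hc : Convex ℝ P) (hK : IsCompact P) (a b c d : ℤ)
    (h : a * d - b * c = 1) :
    ∃ P' : Set (ℝ × ℝ), Convex ℝ P' ∧ IsCompact P' ∧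
      (∀ z : ℤ × ℤ, emb (a * z.1 + b * z.2, c * z.1 + d * z.2) ∈ P' ↔ emb z ∈ P) ∧
      (∀ z : ℤ × ℤ, emb z ∈ P' ↔ emb (d * z.1 - b * z.2, - c * z.1 + a * z.2) ∈ P) ∧
      (InL P').ncard = (InL P).ncard ∧ (FrL P').ncard = (FrL P).ncard := by
  have hr : (a : ℝ) * d - b * c = 1 := by exact_mod_cast h
  let φ : (ℝ × ℝ) ≃ₜ (ℝ × ℝ) :=
    { toFun := fun w => (d * w.1 - b * w.2, - c * w.1 + a * w.2)
      invFun := fun w => (a * w.1 + b * w.2, c * w.1 + d * w.2)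
      left_inv := by
        intro w
        ext <;> simp
        · linear_combination w.1 * hr
        · linear_combination w.2 * hr
      right_inv := by
        intro w
        ext <;> simp
        · linear_combination w.1 * hr
        · linear_combination w.2 * hr
      continuous_toFun := by fun_prop
      continuous_invFun := by fun_prop }
  let ψ : (ℤ × ℤ) ≃ (ℤ × ℤ) :=
    { toFun := fun w => (d * w.1 - b * w.2, - c * w.1 + a * w.2)
      invFun := fun w => (a * w.1 + b * w.2, c * w.1 + d * w.2)
      left_inv := by
        intro w
        ext <;> simp
        · linear_combination w.1 * h
        · linear_combination w.2 * h
      right_inv := by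
        intro w
        ext <;> simp
        · linear_combination w.1 * h
        · linear_combination w.2 * h }
  have hφψ : ∀ z, φ (emb z) = emb (ψ z) := by
    intro z
    simp [φ, ψ, emb]
  have hcard : ∀ A : Set (ℝ × ℝ), {z | emb z ∈ φ ⁻¹' A}.ncard = {z | emb z ∈ A}.ncard := by
    intro A
    have : {z | emb z ∈ φ ⁻¹' A} = ψ ⁻¹' {z | emb z ∈ A} := by
      ext z
      show φ (emb z) ∈ A ↔ emb (ψ z) ∈ A
      rw [hφψ]
    rw [this, Set.ncard_preimage_of_injective_subset_range ψ.injective (by simp [ψ.surjective.range_eq])]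
  refine ⟨φ ⁻¹' P, ?_, φ.isCompact_preimage.2 hK, ?_, ?_, ?_, ?_⟩
  · intro x hx y hy s t hs ht hst
    have := hc hx hy hs ht hst
    rw [Set.mem_preimage]
    convert this using 1
    ext <;> simp [φ] <;> ring
  · intro z
    show φ (emb (ψ.symm z)) ∈ P ↔ _
    rw [hφψ, Equiv.apply_symm_apply]
  · intro z
    show φ (emb z) ∈ P ↔ emb (ψ z) ∈ P
    rw [hφψ]
  · have := hcard (interior P)
    rwa [φ.preimage_interior] at this
  · have := hcard (frontier P)
    rwa [φ.preimage_frontier] at this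

lemma nearest (u u' v v' p : ℤ) (hu : u ≤ u') (hv : v ≤ v') (hs : (u' - u) + (v' - v) < p) :
    ∃ k x x' : ℤ, u ≤ x ∧ x ≤ u' ∧ v ≤ x' ∧ x' ≤ v' ∧
      2 * (x - x' + k * p) ≤ p - ((u' - u) + (v' - v)) ∧
      -(p - ((u' - u) + (v' - v))) ≤ 2 * (x - x' + k * p) := by
  suffices H : ∃ k e : ℤ, u - v' ≤ e ∧ e ≤ u' - v ∧
      2 * (e + k * p) ≤ p - ((u' - u) + (v' - v)) ∧
      -(p - ((u' - u) + (v' - v))) ≤ 2 * (e + k * p) by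
    obtain ⟨k, e, h1, h2, h3, h4⟩ := H
    by_cases h : v ≤ u - e
    · exact ⟨k, u, u - e, le_rfl, hu, h, by omega, by linarith, by linarith⟩
    · exact ⟨k, e + v, v, by omega, by omega, le_rfl, hv, by linarith, by linarith⟩
  have hp : 0 < p := by omega
  have h1 := Int.emod_nonneg (u - v') hp.ne'
  have h2 := Int.emod_lt_of_pos (u - v') hp
  have h3 := Int.emod_add_mul_ediv (u - v') p
  set r := (u - v') % p
  set t := (u - v') / p
  by_cases h4 : 0 ≤ r - p + ((u' - u) + (v' - v))
  · refine ⟨-t - 1, (t + 1) * p, by nlinarith, by nlinarith, by nlinarith, by nlinarith⟩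
  · by_cases h5 : 2 * r ≤ p - ((u' - u) + (v' - v))
    · exact ⟨-t, u - v', le_rfl, by omega, by nlinarith, by nlinarith⟩
    · exact ⟨-t - 1, u' - v, by omega, le_rfl, by nlinarith, by nlinarith⟩

lemma row_ends (P : Set (ℝ × ℝ)) (hK : IsCompact P) (y : ℤ) (h : ∃ x : ℤ, emb (x, y) ∈ P) :
    ∃ v v' : ℤ, emb (v, y) ∈ P ∧ emb (v', y) ∈ P ∧ ∀ x : ℤ, emb (x, y) ∈ P → v ≤ x ∧ x ≤ v' := by
  have hf : {x : ℤ | emb (x, y) ∈ P}.Finite :=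
    (lat_finite P hK).preimage (f := fun x : ℤ => (x, y)) (fun a _ b _ h => by simpa using h)
  obtain ⟨v, h1, h2⟩ := Set.exists_min_image _ id hf h
  obtain ⟨v', h1', h2'⟩ := Set.exists_max_image _ id hf h
  exact ⟨v, v', h1, h1', fun x hx => ⟨h2 x hx, h2' x hx⟩⟩

lemma stepB (P : Set (ℝ × ℝ)) (hc : Convex ℝ P) (hK : IsCompact P) (hI : (InL P).Nonempty)
    (y0 : ℤ) (p : ℕ) (hp : 2 ≤ p)
    (hS : ∀ z : ℤ × ℤ, emb z ∈ P → y0 ≤ z.2 ∧ z.2 ≤ y0 + p)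
    (hbot : ∃ x : ℤ, emb (x, y0) ∈ P) (htop : ∃ x : ℤ, emb (x, y0 + p) ∈ P)
    (hmin : ∀ k : ℤ, ∃ z z' : ℤ × ℤ, emb z ∈ P ∧ emb z' ∈ P ∧
      p ≤ (z'.1 + k * z'.2) - (z.1 + k * z.2)) :
    ((InL P).ncard = 1 ∧ (FrL P).ncard = 9) ∨ (FrL P).ncard ≤ 2 * (InL P).ncard + 6 := by
  have hIf : ∀ P : Set (ℝ × ℝ), IsCompact P → (InL P).Finite := fun P hK =>
    (lat_finite P hK).subset fun z hz => (interior_subset (s := P) hz : emb z ∈ P)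
  have hi : 1 ≤ (InL P).ncard := (Set.ncard_pos (hIf P hK)).2 hI
  obtain ⟨n, rfl⟩ : ∃ n, p = n + 1 := ⟨p - 1, by omega⟩
  push_cast at hS htop hmin
  obtain ⟨v, v', hv, hv', hvv⟩ := row_ends P hK _ hbot
  obtain ⟨u, u', hu, hu', huu⟩ := row_ends P hK _ htop
  have hvle := (hvv v hv).2
  have hule := (huu u hu).2
  obtain ⟨c1, c2⟩ := core P hc hK (hI.elim fun w hw => ⟨emb w, hw⟩) y0 n hS v v' u u' hv hv' hvv hu hu' huu
  have c3 := c2 _ _ hu hu'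
  simp only at c3
  by_cases h1 : n = 1 ∨ 4 ≤ (u' - u) + (v' - v)
  · right
    zify
    rcases h1 with h1 | h1
    · subst h1
      push_cast at *
      linarith
    · have : (2 : ℤ) ≤ (n : ℤ) + 1 := by exact_mod_cast hp
      nlinarith
  push Not at h1
  by_cases h2 : n = 2
  · subst h2
    push_cast at c1
    omega
  right
  have hn : (3 : ℤ) ≤ n := by omega
  obtain ⟨k, x, x', hx1, hx2, hx3, hx4, hx5, hx6⟩ := nearest u u' v v' (n + 1) hule hvle (by omega)
  obtain ⟨P', hc', hK', hP1, hP2, hPI, hPF⟩ := transf P hc hK 1 k 0 1 (by ring)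
  simp only [one_mul, zero_mul, zero_add, neg_zero] at hP1 hP2
  have hI' : (InL P').Nonempty := by
    rw [← Set.ncard_pos (hIf P' hK'), hPI]; omega
  obtain ⟨w, hw⟩ := hI'
  obtain ⟨c1', c2'⟩ := core P' hc' hK' ⟨_, hw⟩ y0 n
    (fun z hz => hS (z.1 - k * z.2, z.2) ((hP2 z).1 hz)) (v + k * y0) (v' + k * y0)
    (u + k * (y0 + (n + 1))) (u' + k * (y0 + (n + 1)))
    ((hP1 (v, y0)).2 hv) ((hP1 (v', y0)).2 hv')
    (fun x hx => by have := hvv _ ((hP2 (x, y0)).1 hx); constructor <;> linarith)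
    ((hP1 (u, _)).2 hu) ((hP1 (u', _)).2 hu')
    (fun x hx => by have := huu _ ((hP2 (x, _)).1 hx); constructor <;> linarith)
  obtain ⟨z, z', hz, hz', hzz⟩ := hmin k
  have c4 := c2' _ _ ((hP1 z).2 hz) ((hP1 z').2 hz')
  simp only at c4
  rw [hPI] at c4
  have b1 := hS z hz
  have b2 := hS z' hz'
  zify
  clear c2 c2' c1' c3 hmin
  generalize ((InL P).ncard : ℤ) = i at *
  generalize ((FrL P).ncard : ℤ) = b at *
  set m' := z'.2 - y0
  set m := z.2 - y0
  have m0 : 0 ≤ m := by simp only [m]; linarith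
  have m1 : m ≤ n + 1 := by simp only [m]; linarith
  have m0' : 0 ≤ m' := by simp only [m']; linarith
  have m1' : m' ≤ n + 1 := by simp only [m']; linarith
  set X := z.1 + k * z.2
  set X' := z'.1 + k * z'.2
  set N : ℤ := (n : ℤ) + 1 with hN
  set s := (u' - u) + (v' - v) with hs
  set e := x - x' + k * N with he
  have d1 : m' * x' ≤ m' * v' := mul_le_mul_of_nonneg_left hx4 m0'
  have d2 : (N - m') * x ≤ (N - m') * u' := mul_le_mul_of_nonneg_left hx2 (by linarith)
  have d3 : m * v ≤ m * x' := mul_le_mul_of_nonneg_left hx3 m0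
  have d4 : (N - m) * u ≤ (N - m) * x := mul_le_mul_of_nonneg_left hx1 (by linarith)
  have d5 : N * N ≤ N * (X' - X) := mul_le_mul_of_nonneg_left hzz (by linarith)
  have d6 : N * N - (m' - m) * e ≤ 2 * i + s + 2 * n := by
    have : N * (X' - X) + (m' * x' + (N - m') * x - m * x' - (N - m) * x) - (m' - m) * (k * N)
      ≤ 2 * i + s + 2 * n := by linarith
    rw [he]; linarith
  have d7 : 2 * ((m' - m) * e) ≤ N * (N - s) := by
    have q1 : |m' - m| ≤ N := abs_le.2 ⟨by linarith, by linarith⟩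
    have q2 : |2 * e| ≤ N - s := abs_le.2 ⟨by linarith, by linarith⟩
    calc 2 * ((m' - m) * e) = (m' - m) * (2 * e) := by ring
      _ ≤ |(m' - m) * (2 * e)| := le_abs_self _
      _ = |m' - m| * |2 * e| := abs_mul _ _
      _ ≤ N * (N - s) := mul_le_mul q1 q2 (abs_nonneg _) (by linarith)
  have s0 : 0 ≤ s := by linarith
  have d8 : 0 ≤ (N - 4) ^ 2 + s * (N - 4) :=
    add_nonneg (sq_nonneg _) (mul_nonneg s0 (by linarith))
  nlinarith

/-- If `P` is a convex polygon whose integral hull `Q = conv(P ∩ ℤ²)` is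
two-dimensional and contains a lattice point in its interior, then either
`(int_P, bnd_P) = (1, 9)` or `bnd_P ≤ 2·int_P + 6`. -/
theorem stmt_10 (V : Finset (ℝ × ℝ)) (P : Set (ℝ × ℝ)) (hP : P = convexHull ℝ ↑V)
    (Q : Set (ℝ × ℝ)) (hQ : Q = convexHull ℝ (P ∩ latticeSet))
    (hdim : ¬ Collinear ℝ (P ∩ latticeSet))
    (hint : ∃ z : ℤ × ℤ, ((z.1 : ℝ), (z.2 : ℝ)) ∈ interior Q) :
    ({z : ℤ × ℤ | ((z.1 : ℝ), (z.2 : ℝ)) ∈ interior P}.ncard = 1 ∧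
      {z : ℤ × ℤ | ((z.1 : ℝ), (z.2 : ℝ)) ∈ frontier P}.ncard = 9) ∨
    {z : ℤ × ℤ | ((z.1 : ℝ), (z.2 : ℝ)) ∈ frontier P}.ncard
      ≤ 2 * {z : ℤ × ℤ | ((z.1 : ℝ), (z.2 : ℝ)) ∈ interior P}.ncard + 6 := by
  have hPc : Convex ℝ P := hP ▸ convex_convexHull ℝ _
  have hPK : IsCompact P := by
    rw [hP]; exact V.finite_toSet.isCompact_convexHull ℝ
  obtain ⟨z0, hz0⟩ := hint
  have hQP : Q ⊆ P := hQ ▸ convexHull_min Set.inter_subset_left hPc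
  have hI : (InL P).Nonempty := ⟨z0, interior_mono hQP hz0⟩
  have hSf := lat_finite P hPK
  have hSne : {z : ℤ × ℤ | emb z ∈ P}.Nonempty := ⟨z0, hQP (interior_subset hz0)⟩
  have hlt : ∀ c d : ℤ, IsCoprime c d → ∃ t : ℤ × ℤ, emb t ∈ P ∧
      c * z0.1 + d * z0.2 < c * t.1 + d * t.2 := by
    intro c d hcd
    by_contra! hcon
    have hcd0 : 0 < (c : ℝ) ^ 2 + (d : ℝ) ^ 2 := by
      have : (c : ℤ) ^ 2 + d ^ 2 ≠ 0 := by
        intro h0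
        have hc0 : c = 0 := by nlinarith [sq_nonneg c, sq_nonneg d]
        have hd0 : d = 0 := by nlinarith [sq_nonneg c, sq_nonneg d]
        subst hc0 hd0
        obtain ⟨g, g', hg⟩ := hcd
        simp at hg
      have h2 : (c : ℝ) ^ 2 + (d : ℝ) ^ 2 ≠ 0 := by exact_mod_cast this
      positivity
    have hsub : Q ⊆ {w : ℝ × ℝ | c * w.1 + d * w.2 ≤ c * z0.1 + d * z0.2} := by
      rw [hQ]
      apply convexHull_min
      · rintro w ⟨hw, t, rfl⟩
        have := hcon t hw
        show (c : ℝ) * t.1 + d * t.2 ≤ c * z0.1 + d * z0.2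
        exact_mod_cast this
      · intro x hx y hy s t hs ht hst
        simp only [Set.mem_ofPred_eq, Prod.fst_add, Prod.snd_add, Prod.smul_fst, Prod.smul_snd,
          smul_eq_mul] at *
        obtain rfl : t = 1 - s := by linarith
        nlinarith
    have hcont : Continuous fun ε : ℝ => ((z0.1 : ℝ) + ε * c, (z0.2 : ℝ) + ε * d) := by fun_prop
    have hev : ∀ᶠ ε in nhds (0 : ℝ), ((z0.1 : ℝ) + ε * c, (z0.2 : ℝ) + ε * d) ∈ interior Q :=
      hcont.continuousAt.eventually_mem (isOpen_interior.mem_nhds (by simpa using hz0))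
    obtain ⟨δ, hδ, hδ'⟩ := Metric.eventually_nhds_iff.1 hev
    have h1 := hsub (interior_subset (hδ' (y := δ / 2) (by
      rw [Real.dist_eq, sub_zero, abs_of_pos (by linarith)]; linarith)))
    simp only [Set.mem_ofPred_eq] at h1
    have : 0 < δ / 2 * ((c : ℝ) ^ 2 + (d : ℝ) ^ 2) := by positivity
    nlinarith
  have hW : ∀ c d : ℤ, ∃ s s' : ℤ × ℤ, emb s ∈ P ∧ emb s' ∈ P ∧ ∀ t, emb t ∈ P →
      c * s.1 + d * s.2 ≤ c * t.1 + d * t.2 ∧ c * t.1 + d * t.2 ≤ c * s'.1 + d * s'.2 := by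
    intro c d
    obtain ⟨s, h1, h2⟩ := Set.exists_min_image _ (fun t : ℤ × ℤ => c * t.1 + d * t.2) hSf hSne
    obtain ⟨s', h1', h2'⟩ := Set.exists_max_image _ (fun t : ℤ × ℤ => c * t.1 + d * t.2) hSf hSne
    exact ⟨s, s', h1, h1', fun t ht => ⟨h2 t ht, h2' t ht⟩⟩
  classical
  have hex : ∃ p : ℕ, ∃ c d : ℤ, IsCoprime c d ∧ ∃ s s' : ℤ × ℤ, emb s ∈ P ∧ emb s' ∈ P ∧
      (c * s'.1 + d * s'.2) - (c * s.1 + d * s.2) = p ∧ ∀ t, emb t ∈ P →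
      c * s.1 + d * s.2 ≤ c * t.1 + d * t.2 ∧ c * t.1 + d * t.2 ≤ c * s'.1 + d * s'.2 := by
    obtain ⟨s, s', h1, h2, h3⟩ := hW 0 1
    have h4 := (h3 s' h2).1
    exact ⟨((0 * s'.1 + 1 * s'.2) - (0 * s.1 + 1 * s.2) : ℤ).toNat, 0, 1, isCoprime_one_right,
      s, s', h1, h2, by rw [Int.toNat_of_nonneg]; linarith, h3⟩
  have hmin := fun m => Nat.find_min' hex (m := m)
  obtain ⟨c, d, hcd, s, s', hs, hs', hss, hst⟩ := Nat.find_spec hex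
  generalize Nat.find hex = p at hmin hss
  have hmin' : ∀ a b : ℤ, IsCoprime a b → ∃ t t' : ℤ × ℤ, emb t ∈ P ∧ emb t' ∈ P ∧
      (p : ℤ) ≤ (a * t'.1 + b * t'.2) - (a * t.1 + b * t.2) := by
    intro a b hab
    obtain ⟨t, t', h1, h2, h3⟩ := hW a b
    have h4 := (h3 t' h2).1
    refine ⟨t, t', h1, h2, ?_⟩
    have := hmin ((a * t'.1 + b * t'.2) - (a * t.1 + b * t.2) : ℤ).toNat
      ⟨a, b, hab, t, t', h1, h2, by rw [Int.toNat_of_nonneg]; linarith, h3⟩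
    omega
  have hp : 2 ≤ p := by
    obtain ⟨t, h1, h2⟩ := hlt c d hcd
    obtain ⟨t', h1', h2'⟩ := hlt (-c) (-d) hcd.neg_neg
    have h3 := (hst t h1).2
    have h4 := (hst t' h1').1
    have : (2 : ℤ) ≤ p := by rw [← hss]; linarith
    exact_mod_cast this
  obtain ⟨b, a, hab⟩ := hcd
  have hdet : a * d - (-b) * c = 1 := by linarith
  obtain ⟨P', hc', hK', hP1, hP2, hPI, hPF⟩ := transf P hPc hPK a (-b) c d hdet
  have hIf : ∀ P : Set (ℝ × ℝ), IsCompact P → (InL P).Finite := fun P hK =>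
    (lat_finite P hK).subset fun z hz => (interior_subset (s := P) hz : emb z ∈ P)
  have hI' : (InL P').Nonempty := by
    rw [← Set.ncard_pos (hIf P' hK'), hPI, Set.ncard_pos (hIf P hPK)]; exact hI
  have fin := stepB P' hc' hK' hI' (c * s.1 + d * s.2) p hp ?_ ⟨_, (hP1 s).2 hs⟩
    ⟨a * s'.1 + -b * s'.2, by
      have := (hP1 s').2 hs'
      rwa [← hss, add_sub_cancel]⟩ ?_
  · rw [hPI, hPF] at fin
    exact fin
  · intro z hz
    have h1 := hst _ ((hP2 z).1 hz)
    have e : c * (d * z.1 - -b * z.2) + d * (-c * z.1 + a * z.2) = z.2 := by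
      linear_combination z.2 * hdet
    simp only [e] at h1
    exact ⟨h1.1, by linarith⟩
  · intro k
    obtain ⟨t, t', h1, h2, h3⟩ := hmin' (a + k * c) (-b + k * d)
      ⟨d, -c, by linear_combination hdet⟩
    exact ⟨_, _, (hP1 t).2 h1, (hP1 t').2 h2, by simp only; linarith⟩
end

section
/- Let s ≥ 2 be an integer and let H be the heptagon with vertices (-1/s, s(s-1)+1), (0, s(s-1)+1), (1, s(s-1)), (s-1+1/s, 0), (1, -s(s-1)), (0, -s(s-1)-1), (-1/s, -s(s-1)-1). Then the Ehrhart quasi-polynomial of H has constant coefficient function identically equal to 1 (minimal period 1) and linear coefficient function of minimal period exactly s. -/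
open Pointwise

lemma hx_interp {C : Set (ℝ × ℝ)} (hC : Convex ℝ C) {a b u v x : ℝ} (h1 : (a, u) ∈ C)
    (h2 : (b, v) ∈ C) (hab : a < b) (hax : a ≤ x) (hxb : x ≤ b) :
    (x, ((b - x) * u + (x - a) * v) / (b - a)) ∈ C := by
  have hd : 0 < b - a := by linarith
  have := hC h1 h2 (a := (b - x) / (b - a)) (b := (x - a) / (b - a))
    (div_nonneg (by linarith) hd.le) (div_nonneg (by linarith) hd.le) (by field_simp; ring)
  convert this using 1
  ext
  · simp; field_simp; ring
  · simp; field_simp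

lemma hx_vert {C : Set (ℝ × ℝ)} (hC : Convex ℝ C) {x u y : ℝ} (h1 : (x, u) ∈ C)
    (h2 : (x, -u) ∈ C) (h3 : y ≤ u) (h4 : -u ≤ y) : (x, y) ∈ C := by
  rcases eq_or_lt_of_le (show -u ≤ u by linarith) with h | h
  · have : y = u := by linarith
    rw [this]; exact h1
  have hu : 0 < u := by linarith
  have := hC h1 h2 (a := (y + u) / (2 * u)) (b := (u - y) / (2 * u))
    (div_nonneg (by linarith) (by linarith)) (div_nonneg (by linarith) (by linarith))
    (by field_simp; ring)
  convert this using 1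
  ext
  · simp; field_simp; ring
  · simp; field_simp; ring

/-- the heptagon with `s = t + 1` -/
def hxH (t : ℝ) : Set (ℝ × ℝ) := convexHull ℝ
      {((-1 : ℝ) / (t + 1), (t + 1) * t + 1), ((0 : ℝ), (t + 1) * t + 1),
       ((1 : ℝ), (t + 1) * t), (t + 1 / (t + 1), 0),
       ((1 : ℝ), -((t + 1) * t)), ((0 : ℝ), -((t + 1) * t) - 1),
       ((-1 : ℝ) / (t + 1), -((t + 1) * t) - 1)}

lemma hx_mem (t : ℝ) (ht : 1 ≤ t) (x y : ℝ) : (x, y) ∈ hxH t ↔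
    (-1 ≤ (t + 1) * x ∧ |y| ≤ (t + 1) * t + 1 ∧ x + |y| ≤ (t + 1) * t + 1 ∧
      (t + 1) ^ 2 * x + t * |y| ≤ (t + 1) * ((t + 1) * t + 1)) := by
  have hs : 0 < t + 1 := by linarith
  constructor
  · intro h
    let D : Set (ℝ × ℝ) := {p | -1 ≤ (t + 1) * p.1 ∧ |p.2| ≤ (t + 1) * t + 1 ∧
      p.1 + |p.2| ≤ (t + 1) * t + 1 ∧
      (t + 1) ^ 2 * p.1 + t * |p.2| ≤ (t + 1) * ((t + 1) * t + 1)}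
    have hD : Convex ℝ D := by
      rintro ⟨x1, y1⟩ ⟨a1, a2, a3, a4⟩ ⟨x2, y2⟩ ⟨b1, b2, b3, b4⟩ a b ha hb hab
      have hy : |a * y1 + b * y2| ≤ a * |y1| + b * |y2| := by
        refine (abs_add_le _ _).trans ?_
        rw [abs_mul, abs_mul, abs_of_nonneg ha, abs_of_nonneg hb]
      have hb' : b = 1 - a := by linarith
      simp only at a1 a2 a3 a4 b1 b2 b3 b4
      have e1 := mul_le_mul_of_nonneg_left a1 ha
      have e2 := mul_le_mul_of_nonneg_left a2 ha
      have e3 := mul_le_mul_of_nonneg_left a3 ha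
      have e4 := mul_le_mul_of_nonneg_left a4 ha
      have f1 := mul_le_mul_of_nonneg_left b1 hb
      have f2 := mul_le_mul_of_nonneg_left b2 hb
      have f3 := mul_le_mul_of_nonneg_left b3 hb
      have f4 := mul_le_mul_of_nonneg_left b4 hb
      have hy' := mul_le_mul_of_nonneg_left hy (show 0 ≤ t by linarith)
      have key : ∀ B : ℝ, a * B + b * B = B := fun B => by rw [← add_mul, hab, one_mul]
      have k1 := key (-1)
      have k2 := key ((t + 1) * t + 1)
      have k3 := key ((t + 1) * ((t + 1) * t + 1))
      refine ⟨?_, ?_, ?_, ?_⟩ <;> simp only [Prod.fst_add, Prod.snd_add, Prod.smul_mk, smul_eq_mul]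
      · linarith
      · linarith
      · linarith
      · linarith
    have hsub : hxH t ⊆ D := by
      refine convexHull_min ?_ hD
      have hB : 0 < (t + 1) * t := by positivity
      intro p hp
      simp only [Set.mem_insert_iff, Set.mem_singleton_iff] at hp
      rcases hp with rfl | rfl | rfl | rfl | rfl | rfl | rfl
      all_goals
        simp only [D, Set.mem_ofPred_eq]
        first
        | rw [abs_of_nonneg (by linarith)]
        | rw [abs_of_nonpos (by linarith)]
        refine ⟨?_, ?_, ?_, ?_⟩
        all_goals
          field_simp
          nlinarith
    exact hsub h
  · rintro ⟨h1, h2, h3, h4⟩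
    have hC : Convex ℝ (hxH t) := convex_convexHull _ _
    have hv : ∀ p ∈ ({((-1 : ℝ) / (t + 1), (t + 1) * t + 1), ((0 : ℝ), (t + 1) * t + 1),
       ((1 : ℝ), (t + 1) * t), (t + 1 / (t + 1), 0),
       ((1 : ℝ), -((t + 1) * t)), ((0 : ℝ), -((t + 1) * t) - 1),
       ((-1 : ℝ) / (t + 1), -((t + 1) * t) - 1)} : Set (ℝ × ℝ)), p ∈ hxH t :=
      fun p hp => subset_convexHull ℝ _ hp
    have v1 := hv ((-1 : ℝ) / (t + 1), (t + 1) * t + 1) (by simp)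
    have v2 := hv ((0 : ℝ), (t + 1) * t + 1) (by simp)
    have v3 := hv ((1 : ℝ), (t + 1) * t) (by simp)
    have v4 := hv (t + 1 / (t + 1), 0) (by simp)
    have v5 := hv ((1 : ℝ), -((t + 1) * t)) (by simp)
    have v6 := hv ((0 : ℝ), -((t + 1) * t) - 1) (by simp)
    have v7 := hv ((-1 : ℝ) / (t + 1), -((t + 1) * t) - 1) (by simp)
    have hneg : (-1 : ℝ) / (t + 1) < 0 := div_neg_of_neg_of_pos (by norm_num) hs
    have hx0 : (-1 : ℝ) / (t + 1) ≤ x := by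
      rw [div_le_iff₀ hs]; linarith
    rcases le_total x 0 with hx | hx
    · have p := hx_interp hC v1 v2 hneg hx0 hx
      have q := hx_interp hC v7 v6 hneg hx0 hx
      have h2' := abs_le.1 h2
      have hne : (0:ℝ) - -1 / (t + 1) ≠ 0 := by linarith
      refine hx_vert hC (u := (t + 1) * t + 1) ?_ ?_ h2'.2 h2'.1
      · convert p using 2
        rw [eq_div_iff hne]; ring
      · convert q using 2
        rw [eq_div_iff hne]; ring
    rcases le_total x 1 with hx' | hx'
    · have p := hx_interp hC v2 v3 (by norm_num) hx hx'
      have q := hx_interp hC v6 v5 (by norm_num) hx hx'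
      have h2' := abs_le.1 (show |y| ≤ (t + 1) * t + 1 - x by linarith)
      refine hx_vert hC (u := (t + 1) * t + 1 - x) ?_ ?_ h2'.2 h2'.1
      · convert p using 2
        ring
      · convert q using 2
        ring
    · have hne : 1 < t + 1 / (t + 1) := by
        have : 0 < 1 / (t + 1) := by positivity
        linarith
      have hxu : x ≤ t + 1 / (t + 1) := by
        have h5 : (t + 1) ^ 2 * x ≤ (t + 1) * ((t + 1) * t + 1) := by
          have : 0 ≤ t * |y| := by positivity
          linarith
        have h6 : (t + 1) * x ≤ (t + 1) * t + 1 := by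
          by_contra hcon
          push Not at hcon
          nlinarith
        have : t + 1 / (t + 1) = ((t + 1) * t + 1) / (t + 1) := by field_simp
        rw [this, le_div_iff₀ hs]; linarith
      have p := hx_interp hC v3 v4 hne hx' hxu
      have q := hx_interp hC v5 v4 hne hx' hxu
      have ht0 : 0 < t := by linarith
      have h2' := abs_le.1 (show |y| ≤ ((t + 1) * ((t + 1) * t + 1) - (t + 1) ^ 2 * x) / t by
        rw [le_div_iff₀ ht0]; linarith)
      have hne' : t + 1 / (t + 1) - 1 = t ^ 2 / (t + 1) := by field_simp; ring
      refine hx_vert hC (u := ((t + 1) * ((t + 1) * t + 1) - (t + 1) ^ 2 * x) / t) ?_ ?_ h2'.2 h2'.1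
      · convert p using 2
        rw [hne']; field_simp; ring
      · convert q using 2
        rw [hne']; field_simp; ring

lemma hx_memn (t n : ℕ) (ht : 1 ≤ t) (hn : 0 < n) (x y : ℤ) :
    ((x : ℝ), (y : ℝ)) ∈ (n : ℝ) • hxH t ↔
    (-(n : ℤ) ≤ (t + 1) * x ∧ |y| ≤ n * ((t + 1) * t + 1) ∧ x + |y| ≤ n * ((t + 1) * t + 1) ∧
      (t + 1) ^ 2 * x + t * |y| ≤ n * ((t + 1) * ((t + 1) * t + 1))) := by
  have hn0 : (0 : ℝ) < n := by exact_mod_cast hn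
  rw [Set.mem_smul_set_iff_inv_smul_mem₀ hn0.ne', Prod.smul_mk, hx_mem _ (by exact_mod_cast ht)]
  simp only [smul_eq_mul, abs_mul, abs_inv, abs_of_pos hn0]
  rw [← Int.cast_le (R := ℝ), ← Int.cast_le (R := ℝ), ← Int.cast_le (R := ℝ), ← Int.cast_le (R := ℝ)]
  push_cast
  have g : ∀ a b : ℝ, a ≤ b ↔ n * a ≤ n * b := fun a b => (mul_le_mul_iff_right₀ hn0).symm
  rw [g (-1), g ((n : ℝ)⁻¹ * |(y : ℝ)|), g ((n : ℝ)⁻¹ * x + _), g ((_ + 1) ^ 2 * _ + _)]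
  have e1 : (n : ℝ) * ((t + 1) * ((n : ℝ)⁻¹ * x)) = (t + 1) * x := by field_simp
  have e2 : (n : ℝ) * ((n : ℝ)⁻¹ * |(y : ℝ)|) = |(y : ℝ)| := by field_simp
  have e3 : (n : ℝ) * ((n : ℝ)⁻¹ * x + (n : ℝ)⁻¹ * |(y : ℝ)|) = x + |(y : ℝ)| := by field_simp
  have e4 : (n : ℝ) * ((t + 1) ^ 2 * ((n : ℝ)⁻¹ * x) + t * ((n : ℝ)⁻¹ * |(y : ℝ)|))
    = (t + 1) ^ 2 * x + t * |(y : ℝ)| := by field_simp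
  rw [e1, e2, e3, e4, mul_neg_one]

lemma hx_tele (f F : ℤ → ℤ) (a b : ℤ) (hab : a ≤ b)
    (h : ∀ x, a < x → x ≤ b → f x = F x - F (x - 1)) :
    ∑ x ∈ Finset.Ioc a b, f x = F b - F a := by
  induction b, hab using Int.le_induction with
  | base => simp
  | succ b hb ih =>
    have : Finset.Ioc a (b + 1) = insert (b + 1) (Finset.Ioc a b) := by
      ext x; simp only [Finset.mem_Ioc, Finset.mem_insert]; omega
    rw [this, Finset.sum_insert (by simp), ih (fun x h1 h2 => h x h1 (by omega)),
      h (b + 1) (by omega) le_rfl]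
    ring_nf

lemma hx_split (f : ℤ → ℤ) (a b c : ℤ) (hab : a ≤ b) (hbc : b ≤ c) :
    ∑ x ∈ Finset.Ioc a c, f x = ∑ x ∈ Finset.Ioc a b, f x + ∑ x ∈ Finset.Ioc b c, f x := by
  rw [← Finset.sum_union]
  · congr 1
    ext x; simp only [Finset.mem_Ioc, Finset.mem_union]; omega
  · rw [Finset.disjoint_left]; intro x; simp only [Finset.mem_Ioc]; omega

/-- half height at abscissa `x` -/
def hxU (t n x : ℤ) : ℤ :=
  if x ≤ 0 then n * ((t + 1) * t + 1) else if x ≤ n then n * ((t + 1) * t + 1) - x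
  else (t + 1) * t * n - (t + 2) * (x - n) + (-(x - n)) / t

lemma hx_count (S : Set (ℤ × ℤ)) (U : ℤ → ℤ) (a b : ℤ)
    (hU : ∀ x, a < x → x ≤ b → 0 ≤ U x)
    (h : ∀ x y, (x, y) ∈ S ↔ (a < x ∧ x ≤ b ∧ |y| ≤ U x)) :
    (S.ncard : ℤ) = ∑ x ∈ Finset.Ioc a b, (2 * U x + 1) := by
  have : S = ((Finset.Ioc a b).biUnion
      (fun x => (({x} : Finset ℤ) ×ˢ Finset.Icc (-U x) (U x))) : Finset (ℤ × ℤ)) := by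
    ext ⟨x, y⟩
    rw [h, abs_le]
    simp only [Finset.coe_biUnion, Set.mem_iUnion, Finset.mem_coe, Finset.mem_product,
      Finset.mem_singleton, Finset.mem_Icc, Finset.mem_Ioc]
    constructor
    · rintro ⟨h1, h2, h3⟩
      exact ⟨x, ⟨h1, h2⟩, rfl, h3⟩
    · rintro ⟨x', ⟨h1, h2⟩, rfl, h3⟩
      exact ⟨h1, h2, h3⟩
  rw [this, Set.ncard_coe_finset, Finset.card_biUnion]
  · push_cast
    refine Finset.sum_congr rfl fun x hx => ?_
    rw [Finset.mem_Ioc] at hx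
    have := hU x hx.1 hx.2
    rw [Finset.card_product, Finset.card_singleton, one_mul, Int.card_Icc, Int.toNat_of_nonneg (by omega)]
    ring
  · intro x _ x' _ hne
    rw [Function.onFun, Finset.disjoint_left]
    rintro ⟨p, q⟩ h1 h2
    simp only [Finset.mem_product, Finset.mem_singleton] at h1 h2
    exact hne (h1.1.symm.trans h2.1)

lemma hx_Ule (t n x y : ℤ) (ht : 1 ≤ t) (hx : n < x) (hn : 0 < n) :
    y ≤ hxU t n x ↔ (t + 1) ^ 2 * x + t * y ≤ n * ((t + 1) * ((t + 1) * t + 1)) := by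
  have : hxU t n x = ((t + 1) * t ^ 2 * n - (t + 1) ^ 2 * (x - n)) / t := by
    rw [hxU, if_neg (by omega), if_neg (by omega),
      show (t + 1) * t ^ 2 * n - (t + 1) ^ 2 * (x - n)
        = -(x - n) + t * ((t + 1) * t * n - (t + 2) * (x - n)) by ring,
      Int.add_mul_ediv_left _ _ (by omega)]
    ring
  rw [this, Int.le_ediv_iff_mul_le (by omega)]
  constructor <;> intro h <;> linarith

lemma hx_ehr (t n : ℕ) (ht : 1 ≤ t) (hn : 0 < n) (k r : ℤ) (hk : 0 ≤ k) (hr : 0 ≤ r) (hrt : r ≤ t)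
    (hnk : (n : ℤ) = (t + 1) * k + r) :
    (ehr (hxH t) n : ℤ) = ∑ x ∈ Finset.Ioc (-k - 1) (n + (t * (n - k) - r)), (2 * hxU t n x + 1) := by
  have ht' : (1 : ℤ) ≤ t := by exact_mod_cast ht
  have hn' : (0 : ℤ) < n := by exact_mod_cast hn
  refine hx_count _ _ _ _ ?_ ?_
  · intro x h1 h2
    rcases lt_or_ge (n : ℤ) x with h | h
    · rw [hx_Ule _ _ _ _ ht' h hn']
      have e : (t + 1) * ((t : ℤ) * (n - k) - r) = t ^ 2 * n - r := by rw [hnk]; ring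
      nlinarith
    · rw [hxU]
      have : (n : ℤ) ≤ n * ((t + 1) * t + 1) := by nlinarith [mul_pos (show (0:ℤ) < t + 1 by omega) (show (0:ℤ) < t by omega)]
      split_ifs <;> omega
  · intro x y
    rw [Set.mem_ofPred_eq, hx_memn t n ht hn]
    have e : (t + 1) * ((t : ℤ) * (n - k) - r) = t ^ 2 * n - r := by rw [hnk]; ring
    have hl : -(n : ℤ) ≤ (t + 1) * x ↔ -k - 1 < x := by
      constructor
      · intro h
        by_contra hc
        push Not at hc
        nlinarith
      · intro h
        have : -k ≤ x := by omega
        nlinarith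
    rw [hl]
    refine and_congr_right fun h1 => ?_
    have hy := abs_nonneg y
    generalize |y| = w at *
    rcases lt_or_ge (n : ℤ) x with h | h
    · rw [hx_Ule _ _ _ _ ht' h hn']
      constructor
      · rintro ⟨-, -, h4⟩
        refine ⟨?_, h4⟩
        by_contra hc
        have hc' : (n : ℤ) + (t * (n - k) - r) + 1 ≤ x := by omega
        have : (t + 1) ^ 2 * x ≤ n * ((t + 1) * (((t : ℤ) + 1) * t + 1)) := by nlinarith
        have : (t + 1) * x ≤ n * (((t : ℤ) + 1) * t + 1) := by
          by_contra hcon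
          push Not at hcon
          nlinarith
        nlinarith
      · rintro ⟨h2, h4⟩
        have h3 : x + w ≤ n * ((t + 1) * t + 1) := by
          have : t * (x + w) ≤ t * (n * (((t : ℤ) + 1) * t + 1)) := by nlinarith
          exact le_of_mul_le_mul_left this (by omega)
        exact ⟨by omega, h3, h4⟩
    · have hJ : 0 ≤ (t : ℤ) * (n - k) - r := by
        have : 0 ≤ (t + 1) * ((t : ℤ) * (n - k) - r) + t := by rw [e]; nlinarith
        by_contra hc
        push Not at hc
        nlinarith
      rw [hxU]
      split_ifs with hx
      · constructor
        · rintro ⟨h2, h3, h4⟩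
          exact ⟨by omega, h2⟩
        · rintro ⟨h2, h3⟩
          refine ⟨h3, by omega, ?_⟩
          nlinarith
      · constructor
        · rintro ⟨h2, h3, h4⟩
          exact ⟨by omega, by omega⟩
        · rintro ⟨h2, h3⟩
          refine ⟨by omega, by omega, ?_⟩
          nlinarith

lemma hx_sum (t n k r : ℤ) (ht : 1 ≤ t) (hn : 0 < n) (hk : 0 ≤ k) (hr : 0 ≤ r) (hrt : r ≤ t)
    (hnk : n = (t + 1) * k + r) :
    ∑ x ∈ Finset.Ioc (-k - 1) (n + (t * (n - k) - r)), (2 * hxU t n x + 1) =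
     (k + 1) * (2 * n * ((t + 1) * t + 1) + 1) + (n * (2 * n * ((t + 1) * t + 1) + 1) - n * (n + 1))
      + ((t * (n - k) - r) * (2 * (t + 1) * t * n + 1) - (t + 2) * (t * (n - k) - r) * (t * (n - k) - r + 1)
        - (t * (n - k) * (n - k + 1) - 2 * r * (n - k))) := by
  have hJ : 0 ≤ (t : ℤ) * (n - k) - r := by
    have : n - k = t * k + r := by rw [hnk]; ring
    rw [this]; nlinarith [mul_nonneg hk (mul_self_nonneg t)]
  rw [hx_split _ (-k - 1) 0 _ (by omega) (by omega), hx_split _ 0 n _ (by omega) (by omega)]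
  rw [hx_tele _ (fun x => x * (2 * n * ((t + 1) * t + 1) + 1)) _ 0 (by omega),
    hx_tele _ (fun x => x * (2 * n * ((t + 1) * t + 1) + 1) - x * (x + 1)) _ n (by omega),
    hx_tele _ (fun x => (x - n) * (2 * (t + 1) * t * n + 1) - (t + 2) * (x - n) * (x - n + 1)
      - (t * (-((-(x - n)) / t)) * (-((-(x - n)) / t) + 1)
        - 2 * (t * (-((-(x - n)) / t)) - (x - n)) * (-((-(x - n)) / t)))) _ _ (by omega)]
  · have key : (t * (-((-(t * (n - k) - r)) / t)) * (-((-(t * (n - k) - r)) / t) + 1)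
        - 2 * (t * (-((-(t * (n - k) - r)) / t)) - (t * (n - k) - r)) * (-((-(t * (n - k) - r)) / t)))
        = (t * (n - k) * (n - k + 1) - 2 * r * (n - k)) := by
      have e1 : -(t * (n - k) - r) / t = r / t - (n - k) := by
        rw [show -(t * (n - k) - r) = r + t * (-(n - k)) by ring, Int.add_mul_ediv_left _ _ (by omega)]
        ring
      rw [e1]
      rcases eq_or_lt_of_le hrt with h | h
      · rw [h, Int.ediv_self (by omega)]; ring
      · rw [Int.ediv_eq_zero_of_lt hr h]; ring
    simp only [add_sub_cancel_left, sub_self, neg_zero, Int.zero_ediv]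
    rw [key]; ring
  · intro x h1 h2
    rw [hxU, if_neg (by omega), if_neg (by omega)]
    have a1 := Int.emod_add_mul_ediv (-(x - n)) t
    have a2 := Int.emod_nonneg (-(x - n)) (show t ≠ 0 by omega)
    have a3 := Int.emod_lt_of_pos (-(x - n)) (show 0 < t by omega)
    have e : -(x - 1 - n) / t = -(x - n) / t ∨
        (-(x - 1 - n) / t = -(x - n) / t + 1 ∧ x - n = 1 - t * (-(x - n) / t + 1)) := by
      generalize -(x - n) % t = m at *
      generalize hq : -(x - n) / t = q at *
      have e0 : -(x - 1 - n) = (m + 1) + t * q := by linarith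
      rw [e0, Int.add_mul_ediv_left _ _ (by omega)]
      rcases eq_or_lt_of_le (show m + 1 ≤ t by omega) with h | h
      · right
        rw [h, Int.ediv_self (by omega)]
        constructor
        · ring
        · linarith
      · left
        rw [Int.ediv_eq_zero_of_lt (by omega) h]; ring
    rcases e with e | ⟨e, e'⟩
    · rw [e]; ring
    · rw [e]
      generalize -(x - n) / t = q at *
      have : x = n + (1 - t * (q + 1)) := by linarith
      subst this
      ring
  · intro x h1 h2
    rw [hxU, if_neg (by omega), if_pos (by omega)]; ring
  · intro x h1 h2
    rw [hxU, if_pos (by omega)]; ring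

/-- For `s ≥ 2`, the heptagon `H` with the seven given vertices has Ehrhart
quasi-polynomial `c₂n² + c₁(n)n + c₀(n)` whose constant coefficient function is
identically `1` (minimal period `1`) and whose linear coefficient function has
minimal period exactly `s`. -/
theorem stmt_19 (s : ℕ) (hs : 2 ≤ s) :
    let H : Set (ℝ × ℝ) := convexHull ℝ
      {((-1 : ℝ) / s, (s : ℝ) * (s - 1) + 1), ((0 : ℝ), (s : ℝ) * (s - 1) + 1),
       ((1 : ℝ), (s : ℝ) * (s - 1)), ((s : ℝ) - 1 + 1 / s, 0),
       ((1 : ℝ), -((s : ℝ) * (s - 1))), ((0 : ℝ), -((s : ℝ) * (s - 1)) - 1),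
       ((-1 : ℝ) / s, -((s : ℝ) * (s - 1)) - 1)}
    ∃ (c₂ : ℚ) (c₁ c₀ : ℕ → ℚ),
      (∀ n : ℕ, 0 < n → (ehr H n : ℚ) = c₂ * n ^ 2 + c₁ n * n + c₀ n) ∧
      (∀ n : ℕ, c₀ n = 1) ∧
      IsLeast {p : ℕ | 0 < p ∧ ∀ n : ℕ, c₀ (n + p) = c₀ n} 1 ∧
      IsLeast {p : ℕ | 0 < p ∧ ∀ n : ℕ, c₁ (n + p) = c₁ n} s := by
  obtain ⟨t, rfl⟩ : ∃ t, s = t + 1 := ⟨s - 1, by omega⟩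
  have ht : 1 ≤ t := by omega
  intro H
  have hH : H = hxH t := by
    simp only [H, hxH]
    push_cast
    simp only [add_sub_cancel_right]
  rw [hH]
  have hs0 : (0 : ℚ) < t + 1 := by positivity
  have hB : (0 : ℚ) < (t + 1) * t + 1 := by positivity
  refine ⟨2 * ((t + 1) * t + 1) / (t + 1) + 2 * ((t + 1) * t) + 1 + t ^ 3,
    fun n => ((t + 1) * t + 1) + 2 - 2 * ((t + 1) * t + 1) * ((n % (t + 1) : ℕ) : ℚ) / (t + 1),
    fun _ => 1, ?_, fun _ => rfl, ⟨⟨one_pos, fun _ => rfl⟩, fun p hp => hp.1⟩,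
    ⟨⟨by omega, fun n => by simp⟩, ?_⟩⟩
  · intro n hn
    have hdm := Nat.mod_add_div n (t + 1)
    have hlt := Nat.mod_lt n (show 0 < t + 1 by omega)
    simp only
    generalize n % (t + 1) = r at *
    generalize n / (t + 1) = k at *
    have hnk : (n : ℤ) = ((t : ℤ) + 1) * k + r := by rw [← hdm]; push_cast; ring
    have hrt : (r : ℤ) ≤ t := by omega
    have e := hx_ehr t n ht hn k r (by positivity) (by positivity) hrt hnk
    rw [hx_sum t n k r (by exact_mod_cast ht) (by exact_mod_cast hn) (by positivity) (by positivity) hrt hnk] at e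
    have e' := congrArg (fun z : ℤ => (z : ℚ)) e
    push_cast at e'
    rw [e']
    have hnk' : (n : ℚ) = ((t : ℚ) + 1) * k + r := by exact_mod_cast hnk
    rw [hnk']
    field_simp
    ring
  · rintro p ⟨hp, h⟩
    by_contra hc
    have hpt : p % (t + 1) = p := Nat.mod_eq_of_lt (by omega)
    have h0 := h 0
    simp only [zero_add, hpt, Nat.zero_mod] at h0
    have hp' : (0 : ℚ) < p := by exact_mod_cast hp
    have : 0 < 2 * (((t : ℚ) + 1) * t + 1) * p / (t + 1) := by positivity
    simp at h0
    rcases h0 with h0 | h0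
    · rcases h0 with h0 | h0
      · linarith
      · omega
    · linarith
end
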